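/- arXiv:1610.03448 — 2 statements merged into one kernel-verified Lean document; each statement's English description precedes it below -/
import Mathlib

section
/- There exists a constant C > 0 depending only on n and W such that for every R ≥ C there is a nondecreasing function g_R : ℝ → [-1,1] with the following properties: (1) g_R is continuous and piecewise C², g_R is constant on (-∞,-R/2] and on [R/2,∞), g_R(0)=0, g_R(R/2)=1, and |g(t) - g_R(t)| ≤ C/R for all t ∈ [-4,4]; (2) the radial function φ_R(x) := g_R(|x|-R) on ℝⁿ satisfies Δφ_R ≤ W'(φ_R) + (C/R)·χ_{B_{R+1}(0)\B_{R-1}(0)} in the viscosity sense, i.e. pointwise at every x where φ_R is twice differentiable, and at the remaining points the inequality holds for every C² function touching φ_R from below. -/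
open MeasureTheory Metric Set Filter RealInnerProductSpace

noncomputable section

/-- The Laplacian of `u : ℝⁿ → ℝ`: the sum of the pure second partial derivatives. -/
def lap (n : ℕ) (u : EuclideanSpace ℝ (Fin n) → ℝ) (x : EuclideanSpace ℝ (Fin n)) : ℝ :=
  ∑ i : Fin n,
    fderiv ℝ (fun y => fderiv ℝ u y (EuclideanSpace.single i 1)) x (EuclideanSpace.single i 1)

/-- `W` is a double-well potential. -/
def DoubleWell (W : ℝ → ℝ) : Prop :=
  ContDiffOn ℝ 2 W (Set.Icc (-1) 1) ∧ W (-1) = 0 ∧ W 1 = 0 ∧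
  (∀ s ∈ Set.Ioo (-1:ℝ) 1, 0 < W s) ∧ deriv W (-1) = 0 ∧ deriv W 1 = 0 ∧
  0 < deriv (deriv W) (-1) ∧ 0 < deriv (deriv W) 1

/-- `g` is the one-dimensional solution of `g'' = W'(g)`, `g' > 0`, `g(0)=0`,
`g(±∞) = ±1`. -/
def IsOneDSolution (W g : ℝ → ℝ) : Prop :=
  ContDiff ℝ 2 g ∧ (∀ t, g t ∈ Set.Ioo (-1:ℝ) 1) ∧
  (∀ t, deriv (deriv g) t = deriv W (g t)) ∧ (∀ t, 0 < deriv g t) ∧ g 0 = 0 ∧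
  Tendsto g atTop (nhds 1) ∧ Tendsto g atBot (nhds (-1))

/-- `Δφ ≤ f` in the viscosity sense: pointwise wherever `φ` is twice differentiable, and at the
remaining points via `C²` functions touching `φ` from below. -/
def ViscSuperLap (n : ℕ) (φ f : EuclideanSpace ℝ (Fin n) → ℝ) : Prop :=
  ∀ x : EuclideanSpace ℝ (Fin n),
    (ContDiffAt ℝ 2 φ x → lap n φ x ≤ f x) ∧
    (¬ ContDiffAt ℝ 2 φ x →
      ∀ ψ : EuclideanSpace ℝ (Fin n) → ℝ, ContDiff ℝ 2 ψ → ψ x = φ x →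
        (∀ y, ψ y ≤ φ y) → lap n ψ x ≤ f x)

open scoped Topology

/-- If `u ≤ v` near `0` with equality at `0`, then `u'' 0 ≤ v'' 0`. -/
lemma second_deriv_le_of_touching {u v u' v' : ℝ → ℝ} {a b : ℝ}
    (huv : ∀ᶠ τ in 𝓝 0, u τ ≤ v τ) (h0 : u 0 = v 0)
    (hu : ∀ᶠ τ in 𝓝 0, HasDerivAt u (u' τ) τ) (hu' : HasDerivAt u' b 0)
    (hv : ∀ᶠ τ in 𝓝 0, HasDerivAt v (v' τ) τ) (hv' : HasDerivAt v' a 0) : b ≤ a := by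
  by_contra! hab
  have hw : ∀ᶠ τ in 𝓝 0, HasDerivAt (fun s => u s - v s) (u' τ - v' τ) τ := by
    filter_upwards [hu, hv] with τ h1 h2 using h1.sub h2
  have hdw : deriv (fun s => u s - v s) =ᶠ[𝓝 0] fun τ => u' τ - v' τ := by
    filter_upwards [hw] with τ h using h.deriv
  have hmax : IsLocalMax (fun s => u s - v s) 0 := by
    filter_upwards [huv] with τ h
    simp only [h0]
    linarith
  have hdd : deriv (deriv (fun s => u s - v s)) 0 = b - a := by
    rw [hdw.deriv_eq]
    exact (hu'.sub hv').deriv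
  have hmin : IsLocalMin (fun s => u s - v s) 0 :=
    isLocalMin_of_deriv_deriv_pos (by rw [hdd]; linarith) hmax.deriv_eq_zero
      hw.self_of_nhds.continuousAt
  have hconst : (fun s => u s - v s) =ᶠ[𝓝 0] fun _ => u 0 - v 0 := by
    filter_upwards [hmax, hmin] with τ h1 h2 using le_antisymm h1 h2
  have hd0 : deriv (fun s => u s - v s) =ᶠ[𝓝 0] fun _ => 0 := by
    filter_upwards [hconst.eventuallyEq_nhds] with τ h
    rw [h.deriv_eq, deriv_const]
  rw [hd0.deriv_eq, deriv_const] at hdd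
  linarith

section Directional

variable {E : Type*} [NormedAddCommGroup E] [NormedSpace ℝ E]

lemma hasDerivAt_line (x e : E) (τ : ℝ) : HasDerivAt (fun s : ℝ => x + s • e) e τ := by
  simpa using ((hasDerivAt_id τ).smul_const e).const_add x

lemma tendsto_line (x e : E) : Tendsto (fun s : ℝ => x + s • e) (𝓝 0) (𝓝 x) := by
  simpa using (hasDerivAt_line x e 0).continuousAt.tendsto

lemma ContDiffAt.eventually_hasDerivAt_line {u : E → ℝ} {x : E} (hu : ContDiffAt ℝ 2 u x)
    (e : E) :
    ∀ᶠ τ : ℝ in 𝓝 0, HasDerivAt (fun s : ℝ => u (x + s • e)) (fderiv ℝ u (x + τ • e) e) τ := by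
  have h1 : ∀ᶠ y in 𝓝 x, ContDiffAt ℝ 2 u y := hu.eventually (by simp)
  filter_upwards [(tendsto_line x e).eventually h1] with τ h
  exact (h.differentiableAt (by simp)).hasFDerivAt.comp_hasDerivAt τ (hasDerivAt_line x e τ)

lemma ContDiffAt.hasDerivAt_fderiv_line {u : E → ℝ} {x : E} (hu : ContDiffAt ℝ 2 u x) (e : E) :
    HasDerivAt (fun τ : ℝ => fderiv ℝ u (x + τ • e) e)
      (fderiv ℝ (fun y => fderiv ℝ u y e) x e) 0 := by
  have h1 : ContDiffAt ℝ 1 (fderiv ℝ u) x := hu.fderiv_right (by norm_num)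
  have h2 : DifferentiableAt ℝ (fun y => fderiv ℝ u y e) x :=
    (h1.differentiableAt (by simp)).clm_apply (differentiableAt_const e)
  have h3 : HasFDerivAt (fun y => fderiv ℝ u y e)
      (fderiv ℝ (fun y => fderiv ℝ u y e) x) (x + (0 : ℝ) • e) := by
    simpa using h2.hasFDerivAt
  exact h3.comp_hasDerivAt (0 : ℝ) (hasDerivAt_line x e 0)

end Directional

lemma lap_nonpos_of_isLocalMax {n : ℕ} {u : EuclideanSpace ℝ (Fin n) → ℝ}
    {x : EuclideanSpace ℝ (Fin n)} (hu : ContDiffAt ℝ 2 u x) (h : IsLocalMax u x) :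
    lap n u x ≤ 0 := by
  refine Finset.sum_nonpos fun i _ => ?_
  exact second_deriv_le_of_touching (v := fun _ => u x) (v' := fun _ => 0)
    ((tendsto_line x _).eventually h) (by simp)
    (hu.eventually_hasDerivAt_line _) (hu.hasDerivAt_fderiv_line _)
    (.of_forall fun τ => hasDerivAt_const _ _) (hasDerivAt_const _ _)

/-- A function touching the radial function `y ↦ H ‖y‖` from below has Laplacian at most
`H'' + (n - 1) / r * H'`. -/
lemma lap_le_of_touching_radial {n : ℕ} {u : EuclideanSpace ℝ (Fin n) → ℝ}
    {x : EuclideanSpace ℝ (Fin n)} (hx : x ≠ 0) (hu : ContDiffAt ℝ 2 u x) {H H' : ℝ → ℝ} {H'' : ℝ}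
    (hH : ∀ᶠ r in 𝓝 ‖x‖, HasDerivAt H (H' r) r) (hH' : HasDerivAt H' H'' ‖x‖)
    (hle : ∀ᶠ y in 𝓝 x, u y ≤ H ‖y‖) (heq : u x = H ‖x‖) :
    lap n u x ≤ H'' + (n - 1) / ‖x‖ * H' ‖x‖ := by
  have hr : 0 < ‖x‖ := norm_pos_iff.2 hx
  have hdir : ∀ i : Fin n,
      fderiv ℝ (fun y => fderiv ℝ u y (EuclideanSpace.single i 1)) x (EuclideanSpace.single i 1)
        ≤ H'' * (x i / ‖x‖) ^ 2 + H' ‖x‖ * (1 / ‖x‖ - x i ^ 2 / ‖x‖ ^ 3) := by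
    intro i
    set e : EuclideanSpace ℝ (Fin n) := EuclideanSpace.single i 1 with he
    have hnorm : ∀ τ : ℝ, ‖x + τ • e‖ ^ 2 = ‖x‖ ^ 2 + 2 * τ * x i + τ ^ 2 := by
      intro τ
      rw [norm_add_sq_real, norm_smul, inner_smul_right, he, EuclideanSpace.inner_single_right]
      simp
      ring
    have hN : ∀ τ : ℝ, x + τ • e ≠ 0 →
        HasDerivAt (fun s : ℝ => ‖x + s • e‖) ((x i + τ) / ‖x + τ • e‖) τ := by
      intro τ hτ
      have h1 : (fun s : ℝ => ‖x + s • e‖)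
          = fun s : ℝ => √(‖x‖ ^ 2 + 2 * s * x i + s ^ 2) := by
        funext s
        rw [← hnorm, Real.sqrt_sq (norm_nonneg _)]
      have h2 : HasDerivAt (fun s : ℝ => ‖x‖ ^ 2 + 2 * s * x i + s ^ 2)
          (2 * x i + 2 * τ) τ := by
        have := ((((hasDerivAt_id τ).const_mul 2).mul_const (x i)).const_add (‖x‖ ^ 2)).fun_add
          ((hasDerivAt_id τ).fun_pow 2)
        simpa using this
      have hpos : 0 < ‖x + τ • e‖ := norm_pos_iff.2 hτ
      have h3 := h2.sqrt (by rw [← hnorm]; positivity)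
      rw [← hnorm, Real.sqrt_sq (norm_nonneg _)] at h3
      rw [h1]
      convert h3 using 1
      field_simp
    have hne : ∀ᶠ τ : ℝ in 𝓝 0, x + τ • e ≠ 0 :=
      (tendsto_line x e).eventually (eventually_ne_nhds hx)
    have hNt : Tendsto (fun s : ℝ => ‖x + s • e‖) (𝓝 0) (𝓝 ‖x‖) := (tendsto_line x e).norm
    have hx0 : x + (0 : ℝ) • e = x := by simp
    have hN0 := hN 0 (by rwa [hx0])
    rw [hx0, add_zero] at hN0
    refine second_deriv_le_of_touching (u := fun τ : ℝ => u (x + τ • e))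
      (v := fun τ : ℝ => H ‖x + τ • e‖)
      (v' := fun τ : ℝ => H' ‖x + τ • e‖ * ((x i + τ) / ‖x + τ • e‖))
      ((tendsto_line x e).eventually hle) (by simpa using heq)
      (hu.eventually_hasDerivAt_line e) (hu.hasDerivAt_fderiv_line e) ?_ ?_
    · filter_upwards [hne, hNt.eventually hH] with τ h1 h2
      exact h2.comp τ (hN τ h1)
    · have h4 : HasDerivAt H' H'' ‖x + (0 : ℝ) • e‖ := by rwa [hx0]
      have h5 : HasDerivAt (fun s : ℝ => H' ‖x + s • e‖) (H'' * (x i / ‖x‖)) 0 :=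
        h4.comp (0 : ℝ) hN0
      have h6 := h5.fun_mul (((hasDerivAt_id (0 : ℝ)).const_add (x i)).fun_div hN0
        (by rw [hx0]; exact hr.ne'))
      refine h6.congr_deriv ?_
      simp only [id, hx0, add_zero]
      field_simp
  calc lap n u x ≤ ∑ i : Fin n,
        (H'' * (x i / ‖x‖) ^ 2 + H' ‖x‖ * (1 / ‖x‖ - x i ^ 2 / ‖x‖ ^ 3)) :=
        Finset.sum_le_sum fun i _ => hdir i
    _ = H'' * ((∑ i, x i ^ 2) / ‖x‖ ^ 2)
        + H' ‖x‖ * (n * (1 / ‖x‖) - (∑ i, x i ^ 2) / ‖x‖ ^ 3) := by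
        rw [Finset.sum_add_distrib, ← Finset.mul_sum, ← Finset.mul_sum,
          Finset.sum_sub_distrib, Finset.sum_div, Finset.sum_div]
        simp [div_pow]
    _ = H'' + (n - 1) / ‖x‖ * H' ‖x‖ := by
        have : ∑ i, x i ^ 2 = ‖x‖ ^ 2 := by
          rw [EuclideanSpace.norm_sq_eq]
          simp
        rw [this]
        field_simp

/-- Solution by quadrature of `h' = √(2 P(h))`, `h 0 = 0`, stopped at the values `σ` and `1`;
`T` is its inverse. -/
lemma exists_profile {P : ℝ → ℝ} {σ R : ℝ} (hσ0 : σ < 0) (hσ1 : -1 ≤ σ) (hR : 0 < R)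
    (hP : ContinuousOn P (Ioo σ 1)) (hlow : ∀ s ∈ Ioo σ 1, (s - σ) / R ≤ 2 * P s) :
    ∃ (h T : ℝ → ℝ) (t₀ t₁ : ℝ), t₀ < 0 ∧ 0 < t₁ ∧ -(3 * √R) ≤ t₀ ∧ t₁ ≤ 3 * √R ∧
      Monotone h ∧ Continuous h ∧ (∀ t ≤ t₀, h t = σ) ∧ (∀ t, t₁ ≤ t → h t = 1) ∧
      (∀ t ∈ Ioo t₀ t₁, h t ∈ Ioo σ 1 ∧ T (h t) = t ∧ HasDerivAt h (√(2 * P (h t))) t) ∧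
      (∀ s ∈ Ioo σ 1, h (T s) = s ∧ HasDerivAt T (1 / √(2 * P s)) s) ∧ h 0 = 0 ∧ T 0 = 0 := by
  have hσ1' : σ < 1 := by linarith
  have hPpos : ∀ s ∈ Ioo σ 1, 0 < 2 * P s := fun s hs =>
    (div_pos (sub_pos.2 hs.1) hR).trans_le (hlow s hs)
  set q : ℝ → ℝ := fun s => 1 / √(2 * P s) with hq
  have hqc : ContinuousOn q (Ioo σ 1) :=
    continuousOn_const.div (hP.const_smul (2 : ℝ)).sqrt fun s hs =>
      (Real.sqrt_pos.2 (hPpos s hs)).ne'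
  have hqpos : ∀ s ∈ Ioo σ 1, 0 < q s := fun s hs =>
    one_div_pos.2 (Real.sqrt_pos.2 (hPpos s hs))
  set D : ℝ → ℝ := fun s => 2 * √R * √(s - σ) with hD
  have hDc : Continuous D := by fun_prop
  have hDd : ∀ s ∈ Ioo σ 1, HasDerivAt D (√R / √(s - σ)) s := by
    intro s hs
    have h0 : 0 < s - σ := sub_pos.2 hs.1
    have h1 := (((hasDerivAt_id s).sub_const σ).sqrt h0.ne').const_mul (2 * √R)
    refine h1.congr_deriv ?_
    simp only [id]
    field_simp
  have hqD : ∀ s ∈ Ioo σ 1, q s ≤ √R / √(s - σ) := by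
    intro s hs
    have h0 : 0 < s - σ := sub_pos.2 hs.1
    rw [← Real.sqrt_div hR.le, hq]
    simp only
    rw [← Real.sqrt_one, ← Real.sqrt_div zero_le_one]
    refine Real.sqrt_le_sqrt ?_
    rw [div_le_div_iff₀ (hPpos s hs) h0]
    have := hlow s hs
    rw [div_le_iff₀ hR] at this
    linarith
  have hDint : IntegrableOn (fun s => √R / √(s - σ)) (Ioo σ 1) :=
    (intervalIntegral.integrableOn_deriv_of_nonneg hDc.continuousOn hDd
      fun s _ => by positivity).mono_set Ioo_subset_Ioc_self
  have hqint : IntegrableOn q (Ioo σ 1) := by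
    refine hDint.mono' (hqc.aestronglyMeasurable measurableSet_Ioo) ?_
    refine (ae_restrict_iff' measurableSet_Ioo).2 (.of_forall fun s hs => ?_)
    rw [Real.norm_of_nonneg (hqpos s hs).le]
    exact hqD s hs
  set p : ℝ → ℝ := fun s => (Ioo σ 1).indicator q s + (Ioo σ 1)ᶜ.indicator (fun _ => 1) s with hp
  have hp_in : ∀ s ∈ Ioo σ 1, p s = q s := fun s hs => by simp [hp, hs]
  have hp_out : ∀ s, s ∉ Ioo σ 1 → p s = 1 := fun s hs => by
    simp only [hp, indicator_of_notMem hs, indicator_of_mem (mem_compl hs), zero_add]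
  have hppos : ∀ s, 0 < p s := fun s => by
    by_cases hs : s ∈ Ioo σ 1
    · rw [hp_in s hs]; exact hqpos s hs
    · rw [hp_out s hs]; exact one_pos
  have hpint : ∀ a b : ℝ, IntervalIntegrable p volume a b := fun a b => by
    refine ((integrable_indicator_iff measurableSet_Ioo).2 hqint).intervalIntegrable.add ?_
    rw [intervalIntegrable_iff]
    exact ((intervalIntegrable_const (c := (1 : ℝ)) (a := a) (b := b)).def').indicator
      measurableSet_Ioo.compl
  set T : ℝ → ℝ := fun s => ∫ x in (0 : ℝ)..s, p x with hT
  have hTc : Continuous T := intervalIntegral.continuous_primitive hpint 0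
  have hTsub : ∀ a b, T b - T a = ∫ x in a..b, p x := fun a b =>
    intervalIntegral.integral_interval_sub_left (hpint 0 b) (hpint 0 a)
  have hTm : StrictMono T := fun a b hab => by
    have := intervalIntegral.intervalIntegral_pos_of_pos (hpint a b) hppos hab
    rw [← hTsub] at this
    linarith
  have hTd : ∀ s ∈ Ioo σ 1, HasDerivAt T (q s) s := by
    intro s hs
    have hev : p =ᶠ[𝓝 s] q := by
      filter_upwards [Ioo_mem_nhds hs.1 hs.2] with y hy using hp_in y hy
    have hqs : ContinuousAt q s := hqc.continuousAt (Ioo_mem_nhds hs.1 hs.2)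
    rw [← hp_in s hs]
    refine intervalIntegral.integral_hasDerivAt_right (hpint 0 s) ?_ (hqs.congr hev.symm)
    refine ⟨Ioo σ 1, Ioo_mem_nhds hs.1 hs.2, ?_⟩
    exact (hqc.congr hp_in).aestronglyMeasurable measurableSet_Ioo
  have hT0 : T 0 = 0 := intervalIntegral.integral_same
  have hTtop : Tendsto T atTop atTop := by
    refine tendsto_atTop_mono' atTop (f₁ := fun s => s + (T 1 - 1)) ?_
      (tendsto_atTop_add_const_right _ _ tendsto_id)
    filter_upwards [eventually_ge_atTop 1] with s hs
    have h1 : ∫ x in (1 : ℝ)..s, p x = ∫ x in (1 : ℝ)..s, (1 : ℝ) := by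
      refine intervalIntegral.integral_congr fun x hx => hp_out x fun hx' => ?_
      rw [uIcc_of_le hs] at hx
      exact absurd hx'.2 (not_lt.2 hx.1)
    have h2 := hTsub 1 s
    rw [h1] at h2
    simp at h2
    linarith
  have hTbot : Tendsto T atBot atBot := by
    refine tendsto_atBot_mono' atBot (f₂ := T) (f₁ := fun s => s + (T σ - σ)) ?_
      (tendsto_atBot_add_const_right _ _ tendsto_id)
    filter_upwards [eventually_le_atBot σ] with s hs
    have h1 : ∫ x in s..σ, p x = ∫ x in s..σ, (1 : ℝ) := by
      refine intervalIntegral.integral_congr fun x hx => hp_out x fun hx' => ?_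
      rw [uIcc_of_le hs] at hx
      exact absurd hx'.1 (not_lt.2 hx.2)
    have h2 := hTsub s σ
    rw [h1] at h2
    simp at h2
    linarith
  set e : ℝ ≃o ℝ := hTm.orderIsoOfSurjective T (hTc.surjective hTtop hTbot) with he
  set G : ℝ → ℝ := fun t => e.symm t
  have hGT : ∀ s, G (T s) = s := fun s => e.symm_apply_apply s
  have hTG : ∀ t, T (G t) = t := fun t => e.apply_symm_apply t
  have hGc : Continuous G := e.symm.continuous
  have hGm : StrictMono G := e.symm.strictMono
  have hmem : ∀ t ∈ Ioo (T σ) (T 1), G t ∈ Ioo σ 1 := fun t ht =>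
    ⟨by rw [← hGT σ]; exact hGm ht.1, by rw [← hGT 1]; exact hGm ht.2⟩
  have hclamp : ∀ t ∈ Ioo (T σ) (T 1), max σ (min 1 (G t)) = G t := fun t ht => by
    rw [min_eq_right (hmem t ht).2.le, max_eq_right (hmem t ht).1.le]
  have hdiff : T 1 - T σ ≤ 3 * √R := by
    have hmono : MonotoneOn (fun s => D s - T s) (Icc σ 1) := by
      refine monotoneOn_of_deriv_nonneg (convex_Icc _ _) (hDc.sub hTc).continuousOn ?_ ?_
      · rw [interior_Icc]
        intro s hs
        exact ((hDd s hs).sub (hTd s hs)).differentiableAt.differentiableWithinAt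
      · rw [interior_Icc]
        intro s hs
        rw [((hDd s hs).fun_sub (hTd s hs)).deriv]
        exact sub_nonneg.2 (hqD s hs)
    have h1 := hmono (left_mem_Icc.2 hσ1'.le) (right_mem_Icc.2 hσ1'.le) hσ1'.le
    have h2 : D σ = 0 := by simp [hD]
    have h3 : √(1 - σ) ≤ 3 / 2 := by
      rw [Real.sqrt_le_left (by norm_num)]
      linarith
    have h4 : D 1 ≤ 3 * √R := by
      simp only [hD]
      nlinarith [Real.sqrt_nonneg R]
    simp only [h2] at h1
    linarith
  have hTσ : T σ < 0 := by rw [← hT0]; exact hTm hσ0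
  have hT1 : 0 < T 1 := by rw [← hT0]; exact hTm one_pos
  refine ⟨fun t => max σ (min 1 (G t)), T, T σ, T 1, hTσ, hT1, by linarith, by linarith,
    fun a b hab => max_le_max le_rfl (min_le_min le_rfl (hGm.monotone hab)),
    continuous_const.max (continuous_const.min hGc), ?_, ?_, ?_, ?_, ?_, hT0⟩
  · intro t ht
    have h1 : G t ≤ σ := by rw [← hGT σ]; exact hGm.monotone ht
    exact max_eq_left ((min_le_right _ _).trans h1)
  · intro t ht
    have h1 : 1 ≤ G t := by rw [← hGT 1]; exact hGm.monotone ht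
    simp only [min_eq_left h1, max_eq_right hσ1'.le]
  · intro t ht
    have hGt := hmem t ht
    simp only [hclamp t ht]
    refine ⟨hGt, hTG t, ?_⟩
    have h1 : HasDerivAt G (q (G t))⁻¹ t :=
      HasDerivAt.of_local_left_inverse hGc.continuousAt (hTd _ hGt) (hqpos _ hGt).ne'
        (.of_forall hTG)
    have h2 : HasDerivAt G (√(2 * P (G t))) t := h1.congr_deriv (by simp [hq])
    refine h2.congr_of_eventuallyEq ?_
    filter_upwards [Ioo_mem_nhds ht.1 ht.2] with y hy using hclamp y hy
  · intro s hs
    have : T s ∈ Ioo (T σ) (T 1) := ⟨hTm hs.1, hTm hs.2⟩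
    exact ⟨(hclamp _ this).trans (hGT s), hTd s hs⟩
  · have h1 : G 0 = 0 := by simpa [hT0] using hGT 0
    simp [h1, hσ0.le]

/-- Near the point where a solution of `h' = √(2 P(h))` leaves the value `σ`, it is bounded by a
parabola. -/
lemma eventually_le_parabola {P h : ℝ → ℝ} {σ t₀ t₁ b : ℝ} (ht : t₀ < t₁) (hc : Continuous h)
    (hleft : ∀ t ≤ t₀, h t = σ)
    (hode : ∀ t ∈ Ioo t₀ t₁, σ < h t ∧ HasDerivAt h (√(2 * P (h t))) t)
    (hb : 0 ≤ b) (hP : ∀ᶠ s in 𝓝[>] σ, P s ≤ b * (s - σ)) :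
    ∀ᶠ t in 𝓝 t₀, h t ≤ σ + b / 2 * (t - t₀) ^ 2 := by
  have h0 : h t₀ = σ := hleft t₀ le_rfl
  have hP' : ∀ᶠ t in 𝓝 t₀, σ < h t → P (h t) ≤ b * (h t - σ) := by
    rw [eventually_nhdsWithin_iff] at hP
    have := hc.tendsto t₀
    rw [h0] at this
    exact this.eventually hP
  obtain ⟨ε, hε, hball⟩ := Metric.eventually_nhds_iff.1 hP'
  filter_upwards [Metric.ball_mem_nhds t₀ hε, Iio_mem_nhds ht] with t hte htt
  rw [Metric.mem_ball, Real.dist_eq] at hte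
  rcases le_or_gt t t₀ with hle | hlt
  · rw [hleft t hle]
    have : 0 ≤ b / 2 * (t - t₀) ^ 2 := by positivity
    linarith
  have hin : ∀ y ∈ Ioo t₀ t, y ∈ Ioo t₀ t₁ := fun y hy => ⟨hy.1, hy.2.trans htt⟩
  have hF : ∀ y ∈ Ioo t₀ t, HasDerivAt (fun y => √(h y - σ) - √(b / 2) * (y - t₀))
      (√(2 * P (h y)) / (2 * √(h y - σ)) - √(b / 2)) y := by
    intro y hy
    obtain ⟨h1, h2⟩ := hode y (hin y hy)
    have h3 := ((h2.sub_const σ).sqrt (sub_pos.2 h1).ne').fun_sub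
      (((hasDerivAt_id y).sub_const t₀).const_mul √(b / 2))
    exact h3.congr_deriv (by ring)
  have hanti : AntitoneOn (fun y => √(h y - σ) - √(b / 2) * (y - t₀)) (Icc t₀ t) := by
    refine antitoneOn_of_deriv_nonpos (convex_Icc _ _) (by fun_prop) ?_ ?_
    · rw [interior_Icc]
      exact fun y hy => (hF y hy).differentiableAt.differentiableWithinAt
    · rw [interior_Icc]
      intro y hy
      rw [(hF y hy).deriv, sub_nonpos]
      have h1 := (hode y (hin y hy)).1
      have h2 : P (h y) ≤ b * (h y - σ) := by
        refine hball ?_ h1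
        rw [Real.dist_eq, abs_of_pos (sub_pos.2 hy.1)]
        rw [abs_of_pos (sub_pos.2 hlt)] at hte
        linarith [hy.2]
      have h3 : 0 < √(h y - σ) := Real.sqrt_pos.2 (sub_pos.2 h1)
      rw [div_le_iff₀ (by positivity)]
      have h4 : √(b / 2) * (2 * √(h y - σ)) = √(2 * (b * (h y - σ))) := by
        rw [show 2 * (b * (h y - σ)) = (b / 2) * (2 ^ 2 * (h y - σ)) by ring,
          Real.sqrt_mul (by positivity), Real.sqrt_mul (by positivity),
          Real.sqrt_sq (by norm_num)]
      rw [h4]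
      exact Real.sqrt_le_sqrt (by linarith)
  have h5 := hanti (left_mem_Icc.2 hlt.le) (right_mem_Icc.2 hlt.le) hlt.le
  simp only [h0, sub_self, Real.sqrt_zero, mul_zero] at h5
  have h6 : 0 ≤ h t - σ := by linarith [(hode t ⟨hlt, htt⟩).1]
  have h7 : h t - σ ≤ (√(b / 2) * (t - t₀)) ^ 2 := by
    rw [← Real.sq_sqrt h6]
    exact pow_le_pow_left₀ (Real.sqrt_nonneg _) (by linarith) 2
  rw [mul_pow, Real.sq_sqrt (by positivity)] at h7
  linarith

section DoubleWell

variable {W g : ℝ → ℝ}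

lemma DoubleWell.contDiffAt (hW : DoubleWell W) {s : ℝ} (hs : s ∈ Ioo (-1 : ℝ) 1) :
    ContDiffAt ℝ 2 W s :=
  hW.1.contDiffAt (Icc_mem_nhds hs.1 hs.2)

lemma DoubleWell.hasDerivAt (hW : DoubleWell W) {s : ℝ} (hs : s ∈ Ioo (-1 : ℝ) 1) :
    HasDerivAt W (deriv W s) s :=
  ((hW.contDiffAt hs).differentiableAt (by simp)).hasDerivAt

lemma DoubleWell.continuousAt_deriv (hW : DoubleWell W) {s : ℝ} (hs : s ∈ Ioo (-1 : ℝ) 1) :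
    ContinuousAt (deriv W) s := by
  have h : ContDiffAt ℝ 1 (fderiv ℝ W) s := (hW.contDiffAt hs).fderiv_right (by norm_num)
  exact h.continuousAt.clm_apply continuousAt_const

lemma DoubleWell.nonneg (hW : DoubleWell W) {s : ℝ} (hs : s ∈ Icc (-1 : ℝ) 1) : 0 ≤ W s := by
  obtain ⟨-, h1, h2, h3, -⟩ := hW
  rcases hs.1.eq_or_lt with rfl | h
  · exact h1.ge
  rcases hs.2.eq_or_lt with rfl | h'
  · exact h2.ge
  exact (h3 s ⟨h, h'⟩).le

/-- Linear growth of `W'` to the right of `-1`. -/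
lemma DoubleWell.exists_linear_bound (hW : DoubleWell W) :
    ∃ m a : ℝ, 0 < m ∧ -1 < a ∧
      ∀ s ∈ Ioc (-1 : ℝ) a, m * (s + 1) ≤ deriv W s ∧ deriv W s ≤ 1 := by
  obtain ⟨-, -, -, -, hd, -, hdd, -⟩ := hW
  have hdiff : HasDerivAt (deriv W) (deriv (deriv W) (-1)) (-1) :=
    (differentiableAt_of_deriv_ne_zero hdd.ne').hasDerivAt
  have h1 : ∀ᶠ s in 𝓝[>] (-1 : ℝ), deriv (deriv W) (-1) / 2 < slope (deriv W) (-1) s :=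
    (hasDerivAt_iff_tendsto_slope.1 hdiff |>.mono_left
      (nhdsWithin_mono _ fun s hs => (mem_Ioi.1 hs).ne')).eventually
      (eventually_gt_nhds (by linarith))
  have h2 : ∀ᶠ s in 𝓝[>] (-1 : ℝ), deriv W s < 1 :=
    (hdiff.continuousAt.tendsto.mono_left nhdsWithin_le_nhds).eventually
      (eventually_lt_nhds (by rw [hd]; norm_num))
  obtain ⟨a, ha, hsub⟩ := mem_nhdsGT_iff_exists_Ioc_subset.1 (h1.and h2)
  refine ⟨_, a, half_pos hdd, ha, fun s hs => ⟨?_, (hsub hs).2.le⟩⟩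
  have h3 := (hsub hs).1
  have h4 : 0 < s + 1 := by linarith [hs.1]
  rw [slope_def_field, hd, sub_zero, sub_neg_eq_add, lt_div_iff₀ h4] at h3
  exact h3.le

lemma IsOneDSolution.hasDerivAt_deriv (hg : IsOneDSolution W g) (t : ℝ) :
    HasDerivAt g (deriv g t) t :=
  (hg.1.differentiable (by simp) t).hasDerivAt

/-- The first integral of `g'' = W'(g)`. -/
lemma IsOneDSolution.hasDerivAt_sqrt (hW : DoubleWell W) (hg : IsOneDSolution W g) (t : ℝ) :
    HasDerivAt g (√(2 * W (g t))) t := by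
  obtain ⟨hg2, hgm, hgode, hgpos, -, hgtop, -⟩ := id hg
  have hg' := hg.hasDerivAt_deriv
  have hg'' : ∀ t, HasDerivAt (deriv g) (deriv W (g t)) t := fun t => by
    rw [← hgode t]
    have : ContDiff ℝ 1 (deriv g) := (contDiff_succ_iff_deriv (n := 1).1 hg2).2.2
    exact (this.differentiable (by simp) t).hasDerivAt
  have hE : ∀ t, HasDerivAt (fun t => deriv g t ^ 2 - 2 * W (g t)) 0 t := fun t => by
    have h1 := ((hg'' t).fun_pow 2).fun_sub
      (((hW.hasDerivAt (hgm t)).comp t (hg' t)).const_mul 2)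
    refine h1.congr_deriv ?_
    simp
    ring
  have hconst : ∀ x y, deriv g x ^ 2 - 2 * W (g x) = deriv g y ^ 2 - 2 * W (g y) :=
    is_const_of_deriv_eq_zero (fun t => (hE t).differentiableAt) fun t => (hE t).deriv
  have hmvt : ∀ k : ℕ, ∃ ξ ∈ Ioo (k : ℝ) (k + 1), deriv g ξ = g (k + 1) - g k := fun k => by
    obtain ⟨ξ, hξ, h⟩ := exists_hasDerivAt_eq_slope g (deriv g) (lt_add_one (k : ℝ))
      hg2.continuous.continuousOn fun x _ => hg' x
    exact ⟨ξ, hξ, by simpa using h⟩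
  choose ξ hξ hξd using hmvt
  have hk : Tendsto (fun k : ℕ => (k : ℝ)) atTop atTop := tendsto_natCast_atTop_atTop
  have hξtop : Tendsto ξ atTop atTop := tendsto_atTop_mono (fun k => (hξ k).1.le) hk
  have hgξ : Tendsto (fun k => deriv g (ξ k)) atTop (𝓝 0) := by
    simp only [hξd]
    simpa using (hgtop.comp (tendsto_atTop_add_const_right _ (1 : ℝ) hk)).sub (hgtop.comp hk)
  have hWξ : Tendsto (fun k => W (g (ξ k))) atTop (𝓝 0) := by
    have h1 : Tendsto W (𝓝[Icc (-1) 1] 1) (𝓝 (W 1)) := hW.1.continuousOn 1 (by simp)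
    rw [hW.2.2.1] at h1
    exact h1.comp (tendsto_nhdsWithin_iff.2
      ⟨hgtop.comp hξtop, .of_forall fun k => Ioo_subset_Icc_self (hgm _)⟩)
  have hlim : Tendsto (fun k => deriv g (ξ k) ^ 2 - 2 * W (g (ξ k))) atTop (𝓝 0) := by
    simpa using (hgξ.pow 2).sub (hWξ.const_mul 2)
  simp only [fun k => hconst (ξ k) t] at hlim
  have h0 := tendsto_nhds_unique hlim tendsto_const_nhds
  rw [show 2 * W (g t) = deriv g t ^ 2 by linarith, Real.sqrt_sq (hgpos t).le]
  exact hg' t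

end DoubleWell

/-- A smooth correction, affine with slope `-K` off `[0, d]`, which jumps from `-B` to `B`
across `[0, d]`. -/
lemma exists_correction {K B d : ℝ} (hK : 0 ≤ K) (hB : 0 ≤ B) (hd : 0 < d) :
    ∃ (Q Q' : ℝ → ℝ) (L : ℝ), (∀ s, HasDerivAt Q (Q' s) s) ∧ Continuous Q' ∧
      (∀ s ∈ Icc (-1 : ℝ) 1, |Q s| ≤ B + K) ∧ (∀ s < 0, Q s = -B - K * s) ∧
      (∀ s, d ≤ s → Q s = B - K * s) ∧ (∀ s, s < 0 ∨ d < s → Q' s = -K) ∧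
      (∀ s ∈ Icc (-1 : ℝ) 1, Q' s + K ≤ L) := by
  set Q : ℝ → ℝ := fun s => B * (2 * Real.smoothTransition (s / d) - 1) - K * s with hQ
  have hQC : ContDiff ℝ 1 Q := by
    have : ContDiff ℝ 1 fun s : ℝ => Real.smoothTransition (s / d) :=
      (Real.smoothTransition.contDiff (n := 1)).comp (contDiff_id.div_const d)
    exact (contDiff_const.mul ((contDiff_const.mul this).sub contDiff_const)).sub
      (contDiff_const.mul contDiff_id)
  have hQd : ∀ s, HasDerivAt Q (deriv Q s) s := fun s =>
    (hQC.differentiable (by simp) s).hasDerivAt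
  have hQ'c : Continuous (deriv Q) := hQC.continuous_deriv (by simp)
  have hneg : ∀ s < 0, Q s = -B - K * s := fun s hs => by
    simp only [hQ,
      Real.smoothTransition.zero_of_nonpos (div_nonpos_of_nonpos_of_nonneg hs.le hd.le)]
    ring
  have hpos : ∀ s, d ≤ s → Q s = B - K * s := fun s hs => by
    simp only [hQ, Real.smoothTransition.one_of_one_le ((one_le_div hd).2 hs)]
    ring
  have haff : ∀ c s : ℝ, deriv (fun s => c - K * s) s = -K := fun c s => by
    simp
  obtain ⟨L, hL⟩ := isCompact_Icc.bddAbove_image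
    (hQ'c.add (continuous_const (y := K))).continuousOn (K := Icc (-1 : ℝ) 1)
  refine ⟨Q, deriv Q, L, hQd, hQ'c, ?_, hneg, hpos, ?_, fun s hs => hL (mem_image_of_mem _ hs)⟩
  · intro s hs
    have h0 := Real.smoothTransition.nonneg (s / d)
    have h1 := Real.smoothTransition.le_one (s / d)
    have h2 : |2 * Real.smoothTransition (s / d) - 1| ≤ 1 := abs_le.2 ⟨by linarith, by linarith⟩
    have h3 : |s| ≤ 1 := abs_le.2 hs
    calc |Q s| ≤ |B * (2 * Real.smoothTransition (s / d) - 1)| + |K * s| := abs_sub _ _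
      _ ≤ B * 1 + K * 1 := by
        rw [abs_mul, abs_mul, abs_of_nonneg hB, abs_of_nonneg hK]
        gcongr
      _ = B + K := by ring
  · rintro s (hs | hs)
    · have : Q =ᶠ[𝓝 s] fun s => -B - K * s := by
        filter_upwards [Iio_mem_nhds hs] with y hy using hneg y hy
      rw [this.deriv_eq, haff]
    · have : Q =ᶠ[𝓝 s] fun s => B - K * s := by
        filter_upwards [Ioi_mem_nhds hs] with y hy using hpos y (mem_Ioi.1 hy).le
      rw [this.deriv_eq, haff]

/-- The perturbed potential `W + Q / R` vanishes at some `σ` close to `-1` and grows at least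
linearly to the right of it. -/
lemma exists_zero_of_perturbed {W Q Q' : ℝ → ℝ} {a m K B R d : ℝ} (hW : DoubleWell W)
    (ha : -1 < a) (ha0 : a < 0) (hm : 0 < m)
    (hWa : ∀ s ∈ Ioc (-1 : ℝ) a, m * (s + 1) ≤ deriv W s ∧ deriv W s ≤ 1) (hR : 0 < R)
    (hd : 0 < d) (hK : 0 ≤ K) (hB : B = K + 1 + (K + 1) / m)
    (hQ : ∀ s, HasDerivAt Q (Q' s) s) (hQneg : ∀ s < 0, Q s = -B - K * s)
    (hQpos : ∀ s, d ≤ s → Q s = B - K * s) (hQ' : ∀ s < 0, Q' s = -K)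
    (hmid : ∀ s ∈ Icc a d, 1 / R ≤ W s + Q s / R) :
    ∃ σ ∈ Ioo (-1) a, W σ + Q σ / R = 0 ∧
      ∀ s ∈ Icc σ 1, (s - σ) / R ≤ 2 * (W s + Q s / R) := by
  have hBK : K + 1 ≤ m * (B - K) := by
    rw [hB]
    field_simp
    nlinarith
  have hB1 : 1 ≤ B - K := by
    have : 0 ≤ (K + 1) / m := by positivity
    linarith
  have hQc : Continuous Q := continuous_iff_continuousAt.2 fun s => (hQ s).continuousAt
  have hWc : ContinuousOn W (Icc (-1) 1) := hW.1.continuousOn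
  have hPc : ContinuousOn (fun s => W s + Q s / R) (Icc (-1) 1) :=
    hWc.add (hQc.div_const R).continuousOn
  have hPd : ∀ s ∈ Ioo (-1 : ℝ) 1,
      HasDerivAt (fun s => W s + Q s / R) (deriv W s + Q' s / R) s :=
    fun s hs => (hW.hasDerivAt hs).add ((hQ s).div_const R)
  have hP1 : W (-1) + Q (-1) / R < 0 := by
    rw [hW.2.1, hQneg _ (by norm_num), zero_add]
    exact div_neg_of_neg_of_pos (by linarith) hR
  have hPa : 0 < W a + Q a / R :=
    (one_div_pos.2 hR).trans_le (hmid a ⟨le_rfl, (ha0.trans hd).le⟩)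
  obtain ⟨σ, hσ, hσ0⟩ := intermediate_value_Ioo ha.le
    (hPc.mono (Icc_subset_Icc_right (by linarith))) ⟨hP1, hPa⟩
  simp only at hσ0
  refine ⟨σ, hσ, hσ0, fun s hs => ?_⟩
  have hWσ : W σ ≤ σ + 1 := by
    obtain ⟨c, hc, h⟩ := exists_hasDerivAt_eq_slope W (deriv W) hσ.1
      (hWc.mono (Icc_subset_Icc_right (by linarith [hσ.2])))
      fun x hx => hW.hasDerivAt ⟨hx.1, by linarith [hx.2, hσ.2]⟩
    have h1 := (hWa c ⟨hc.1, (hc.2.trans hσ.2).le⟩).2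
    rw [h, hW.2.1, div_le_one (by linarith [hσ.1])] at h1
    linarith
  have hσm : (K + 1) / R ≤ m * (σ + 1) := by
    have h1 : W σ = (B + K * σ) / R := by
      rw [hQneg σ (hσ.2.trans ha0)] at hσ0
      have : (B + K * σ) / R = -((-B - K * σ) / R) := by ring
      linarith
    have h2 : (B - K) / R ≤ σ + 1 := by
      refine le_trans ?_ (h1 ▸ hWσ)
      gcongr
      nlinarith [hσ.1]
    calc (K + 1) / R ≤ m * (B - K) / R := by gcongr
      _ = m * ((B - K) / R) := by ring
      _ ≤ m * (σ + 1) := by gcongr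
  have hs2 : (s - σ) / R ≤ 2 * (1 / R) := by
    rw [mul_one_div]
    gcongr
    linarith [hs.2, hσ.1]
  rcases le_or_gt s a with hsa | hsa
  · rcases hs.1.eq_or_lt with rfl | hσs
    · rw [hσ0]; simp
    obtain ⟨c, hc, h⟩ := exists_hasDerivAt_eq_slope (fun s => W s + Q s / R)
      (fun s => deriv W s + Q' s / R) hσs (hPc.mono (Icc_subset_Icc hσ.1.le hs.2))
      fun x hx => hPd x ⟨hσ.1.trans hx.1, hx.2.trans_le hs.2⟩
    simp only [hσ0, sub_zero] at h
    rw [eq_div_iff (sub_pos.2 hσs).ne', hQ' c (by linarith [hc.2])] at h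
    have h1 := (hWa c ⟨hσ.1.trans hc.1, by linarith [hc.2]⟩).1
    have h2 : m * (σ + 1) ≤ m * (c + 1) := by
      have := hc.1
      gcongr
    have h3 : 1 / R ≤ deriv W c + -K / R := by
      have : (K + 1) / R = K / R + 1 / R := by ring
      have : -K / R = -(K / R) := by ring
      linarith
    have h4 : 1 / R * (s - σ) ≤ W s + Q s / R := by
      rw [← h]
      exact mul_le_mul_of_nonneg_right h3 (by linarith)
    have h5 : 0 ≤ 1 / R * (s - σ) := mul_nonneg (by positivity) (by linarith)
    have h6 : (s - σ) / R = 1 / R * (s - σ) := by ring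
    linarith
  rcases le_or_gt s d with hsd | hsd
  · linarith [hmid s ⟨hsa.le, hsd⟩]
  · have h1 := hW.nonneg (s := s) ⟨by linarith, hs.2⟩
    have h2 : 1 / R ≤ Q s / R := by
      rw [hQpos s hsd.le]
      gcongr
      nlinarith [hs.2]
    linarith

lemma abs_sqrt_div_sqrt_sub_one_le {x y : ℝ} (hx : 0 ≤ x) (hy : 0 < y) :
    |√x / √y - 1| ≤ |x - y| / y := by
  rw [← Real.sqrt_div hx]
  have hz : 0 ≤ x / y := by positivity
  have h1 : x / y - 1 = (√(x / y) - 1) * (√(x / y) + 1) := by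
    linear_combination -(Real.sq_sqrt hz)
  have h2 : |x - y| / y = |x / y - 1| := by
    rw [← abs_of_pos hy, ← abs_div, abs_of_pos hy, sub_div, div_self hy.ne']
  rw [h2, h1, abs_mul]
  refine le_mul_of_one_le_right (abs_nonneg _) ?_
  rw [abs_of_nonneg (by positivity)]
  linarith [Real.sqrt_nonneg (x / y)]

/-- Solutions of `g' = √(2 U(g))` and travel times of `√(2 P)` stay close if `U` and `P` do. -/
lemma abs_travel_time_sub_le {U P g T : ℝ → ℝ} {w η ℓ : ℝ} (hw : 0 < w)
    (hg : ∀ t, HasDerivAt g (√(2 * U (g t))) t) (hU : ∀ t ∈ Icc (-ℓ) ℓ, 0 ≤ U (g t))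
    (hP : ∀ t ∈ Icc (-ℓ) ℓ, w ≤ P (g t)) (hUP : ∀ t ∈ Icc (-ℓ) ℓ, |U (g t) - P (g t)| ≤ η)
    (hT : ∀ t ∈ Icc (-ℓ) ℓ, HasDerivAt T (1 / √(2 * P (g t))) (g t)) (hT0 : T (g 0) = 0) :
    ∀ t ∈ Icc (-ℓ) ℓ, |T (g t) - t| ≤ η / w * ℓ := by
  intro t ht
  have hℓ : 0 ≤ ℓ := by linarith [ht.1, ht.2]
  have h0 : (0 : ℝ) ∈ Icc (-ℓ) ℓ := ⟨by linarith, hℓ⟩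
  have hη : 0 ≤ η := (abs_nonneg _).trans (hUP 0 h0)
  have h1 := (convex_Icc (-ℓ) ℓ).norm_image_sub_le_of_norm_hasDerivWithin_le
    (f := fun t => T (g t) - t) (f' := fun t => √(2 * U (g t)) / √(2 * P (g t)) - 1)
    (C := η / w) (fun y hy => ?_) (fun y hy => ?_) h0 ht
  · simp only [hT0, sub_zero, Real.norm_eq_abs] at h1
    refine h1.trans ?_
    have : |t| ≤ ℓ := abs_le.2 ht
    gcongr
  · have h2 := ((hT y hy).comp y (hg y)).fun_sub (hasDerivAt_id y)
    refine (h2.congr_deriv ?_).hasDerivWithinAt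
    ring
  · have hPy := hP y hy
    rw [Real.norm_eq_abs]
    refine (abs_sqrt_div_sqrt_sub_one_le (by linarith [hU y hy]) (by linarith)).trans ?_
    rw [← mul_sub, abs_mul, abs_two, mul_div_mul_left _ _ two_ne_zero]
    exact div_le_div₀ hη (hUP y hy) hw hPy

lemma contDiffOn_two_of_hasDerivAt {h h' h'' : ℝ → ℝ} {s : Set ℝ} (hs : IsOpen s)
    (h1 : ∀ t ∈ s, HasDerivAt h (h' t) t) (h2 : ∀ t ∈ s, HasDerivAt h' (h'' t) t)
    (h3 : ContinuousOn h'' s) : ContDiffOn ℝ 2 h s := by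
  have hone : ContDiffOn ℝ (0 + 1) h' s := by
    rw [contDiffOn_succ_iff_deriv_of_isOpen hs]
    refine ⟨fun t ht => (h2 t ht).differentiableAt.differentiableWithinAt, by simp, ?_⟩
    rw [contDiffOn_zero]
    exact h3.congr fun t ht => (h2 t ht).deriv
  have htwo : ContDiffOn ℝ (1 + 1) h s := by
    rw [contDiffOn_succ_iff_deriv_of_isOpen hs]
    refine ⟨fun t ht => (h1 t ht).differentiableAt.differentiableWithinAt, by simp, ?_⟩
    rw [zero_add] at hone
    exact hone.congr fun t ht => (h1 t ht).deriv
  rwa [one_add_one_eq_two] at htwo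

lemma hasDerivAt_sqrt_comp_of_ode {P h : ℝ → ℝ} {p' t : ℝ} (hP : HasDerivAt P p' (h t))
    (hpos : 0 < P (h t)) (hh : HasDerivAt h (√(2 * P (h t))) t) :
    HasDerivAt (fun t => √(2 * P (h t))) p' t := by
  have h1 := ((hP.comp t hh).const_mul 2).sqrt (by simpa using hpos.ne')
  refine h1.congr_deriv ?_
  have : 0 < √(2 * P (h t)) := Real.sqrt_pos.2 (by linarith)
  simp only [Function.comp]
  field_simp

/-- Laplacian bounds for functions touching `x ↦ h (‖x‖ - R)` from below, where
`h' = √(2 P(h))` between the times `t₀` and `t₁` and `h` is constant elsewhere. -/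
lemma lap_le_of_touching_profile {n : ℕ} {P P' h : ℝ → ℝ} {σ t₀ t₁ R M Z : ℝ}
    {u : EuclideanSpace ℝ (Fin n) → ℝ} {x : EuclideanSpace ℝ (Fin n)} (hR : 0 < R)
    (ht : t₀ < t₁) (hRt : -(R / 2) ≤ t₀) (hc : Continuous h) (hle : ∀ t, h t ≤ 1)
    (hleft : ∀ t ≤ t₀, h t = σ) (hright : ∀ t, t₁ ≤ t → h t = 1)
    (hode : ∀ t ∈ Ioo t₀ t₁, h t ∈ Ioo σ 1 ∧ HasDerivAt h (√(2 * P (h t))) t)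
    (hP : ∀ s ∈ Ico σ 1, HasDerivAt P (P' s) s) (hσ : σ < 1) (hPσ : P σ = 0)
    (hPpos : ∀ s ∈ Ioo σ 1, 0 < P s) (hM : ∀ s ∈ Ioo σ 1, √(2 * P s) ≤ M)
    (hu : ContDiffAt ℝ 2 u x) (hux : ∀ y, u y ≤ h (‖y‖ - R)) (heq : u x = h (‖x‖ - R))
    (hZ : ‖x‖ - R ∈ Ioo t₀ t₁ → P' (h (‖x‖ - R)) + 2 * n * M / R ≤ Z)
    (hZ₀ : ‖x‖ - R = t₀ → P' σ < Z) (hZc : ‖x‖ - R ≤ t₀ ∨ t₁ ≤ ‖x‖ - R → 0 ≤ Z) :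
    lap n u x ≤ Z := by
  have hnc : Continuous fun y : EuclideanSpace ℝ (Fin n) => ‖y‖ - R := by fun_prop
  rcases lt_or_ge (‖x‖ - R) t₀ with hlt | hge
  · refine (lap_nonpos_of_isLocalMax hu ?_).trans (hZc (.inl hlt.le))
    filter_upwards [hnc.continuousAt.eventually (eventually_lt_nhds hlt)] with y hy
    rw [heq, hleft _ hlt.le, ← hleft _ hy.le]
    exact hux y
  rcases le_or_gt t₁ (‖x‖ - R) with hle₁ | hlt₁
  · refine (lap_nonpos_of_isLocalMax hu (.of_forall fun y => ?_)).trans (hZc (.inr hle₁))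
    rw [heq, hright _ hle₁]
    exact (hux y).trans (hle _)
  have hr : R / 2 ≤ ‖x‖ := by linarith
  have hr0 : 0 < ‖x‖ := by linarith
  have hx : x ≠ 0 := norm_pos_iff.1 hr0
  rcases hge.eq_or_lt with heq₀ | hgt
  · have hZ0 := hZc (.inl heq₀.ge)
    have hPZ : ∀ᶠ s in 𝓝[>] σ, P s ≤ Z * (s - σ) := by
      have h1 : ∀ᶠ s in 𝓝[>] σ, slope P σ s < Z :=
        (hasDerivAt_iff_tendsto_slope.1 (hP σ ⟨le_rfl, hσ⟩) |>.mono_left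
          (nhdsWithin_mono _ fun s hs => (mem_Ioi.1 hs).ne')).eventually
          (eventually_lt_nhds (hZ₀ heq₀.symm))
      filter_upwards [h1, self_mem_nhdsWithin] with s hs hs'
      rw [slope_def_field, hPσ, sub_zero, div_lt_iff₀ (sub_pos.2 hs')] at hs
      exact hs.le
    have hpar := eventually_le_parabola ht hc hleft (fun t ht => ⟨(hode t ht).1.1, (hode t ht).2⟩)
      hZ0 hPZ
    have hpar' : ∀ᶠ y in 𝓝 x, u y ≤ σ + Z / 2 * (‖y‖ - R - t₀) ^ 2 := by
      have := hnc.tendsto x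
      rw [← heq₀] at this
      filter_upwards [this.eventually hpar] with y hy using (hux y).trans hy
    have hx0 : ‖x‖ - R - t₀ = 0 := by rw [← heq₀, sub_self]
    have h1 : ∀ r : ℝ, HasDerivAt (fun r => r - R - t₀) 1 r := fun r =>
      ((hasDerivAt_id r).sub_const R).sub_const t₀
    have key := lap_le_of_touching_radial hx hu
      (H := fun r => σ + Z / 2 * (r - R - t₀) ^ 2) (H' := fun r => Z * (r - R - t₀)) (H'' := Z)
      (.of_forall fun r => ((((h1 r).fun_pow 2).const_mul (Z / 2)).const_add σ).congr_deriv
        (by simp; ring))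
      (((h1 _).const_mul Z).congr_deriv (by ring)) hpar' (by simp [hx0, heq, hleft _ heq₀.ge])
    simpa [hx0] using key
  · have hmem : ‖x‖ - R ∈ Ioo t₀ t₁ := ⟨hgt, hlt₁⟩
    obtain ⟨hs, hd⟩ := hode _ hmem
    have h2 := hasDerivAt_sqrt_comp_of_ode (hP _ (Ioo_subset_Ico_self hs)) (hPpos _ hs) hd
    have key := lap_le_of_touching_radial hx hu (H := fun r => h (r - R))
      (H' := fun r => √(2 * P (h (r - R)))) ?_ (h2.comp_sub_const ‖x‖ R) (.of_forall hux) heq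
    · refine key.trans (le_trans ?_ (hZ hmem))
      gcongr
      have h3 : 0 ≤ √(2 * P (h (‖x‖ - R))) := Real.sqrt_nonneg _
      calc (n - 1) / ‖x‖ * √(2 * P (h (‖x‖ - R))) ≤ n / (R / 2) * M := by
            gcongr
            · linarith
            · exact hM _ hs
        _ = 2 * n * M / R := by field_simp
    · have h4 : ContinuousAt (fun r : ℝ => r - R) ‖x‖ := by fun_prop
      filter_upwards [h4.eventually (Ioo_mem_nhds hgt hlt₁)] with r hr
      exact (hode _ hr).2.comp_sub_const r R

lemma DoubleWell.exists_speed_bound {W : ℝ → ℝ} (hW : DoubleWell W) :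
    ∃ M : ℝ, 0 < M ∧ ∀ s ∈ Icc (-1 : ℝ) 1, √(2 * (W s + 1)) ≤ M := by
  have hc : ContinuousOn (fun s => √(2 * (W s + 1))) (Icc (-1 : ℝ) 1) :=
    (continuousOn_const.mul (hW.1.continuousOn.add continuousOn_const)).sqrt
  obtain ⟨M, hM⟩ := isCompact_Icc.bddAbove_image hc
  exact ⟨max M 1, by positivity, fun s hs => (hM (mem_image_of_mem _ hs)).trans (le_max_left _ _)⟩

lemma DoubleWell.exists_lower_bound {W : ℝ → ℝ} (hW : DoubleWell W) {a b : ℝ} (ha : -1 < a)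
    (hb : b < 1) : ∃ w : ℝ, 0 < w ∧ ∀ s ∈ Icc a b, 2 * w ≤ W s := by
  rcases (Icc a b).eq_empty_or_nonempty with h | h
  · exact ⟨1, one_pos, by simp [h]⟩
  have hsub : Icc a b ⊆ Ioo (-1 : ℝ) 1 := fun s hs => ⟨ha.trans_le hs.1, hs.2.trans_lt hb⟩
  obtain ⟨s, hs, hmin⟩ := isCompact_Icc.exists_isMinOn h
    (hW.1.continuousOn.mono (hsub.trans Ioo_subset_Icc_self))
  have := hW.2.2.2.1 s (hsub hs)
  exact ⟨W s / 2, by linarith, fun t ht => by linarith [isMinOn_iff.1 hmin t ht]⟩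

/-- If a monotone `h` has the travel time function `T` as an inverse and `T ∘ g` is close to the
identity, then `g` and `h` are close. -/
lemma abs_sub_le_of_travel_time {g g' h T : ℝ → ℝ} {M δ : ℝ} (hM : 0 ≤ M)
    (hg : ∀ t, HasDerivAt g (g' t) t) (hg' : ∀ t, |g' t| ≤ M) (hmono : Monotone h)
    (hhT : ∀ τ ∈ Icc (-5 : ℝ) 5, h (T (g τ)) = g τ)
    (hT : ∀ τ ∈ Icc (-5 : ℝ) 5, |T (g τ) - τ| ≤ δ) (hδ : δ ≤ 1 / 2)
    (hTh : ∀ t, h t ∈ Icc (g (-5)) (g 5) → T (h t) = t) :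
    ∀ t ∈ Icc (-4 : ℝ) 4, |g t - h t| ≤ M * δ := by
  intro t ht
  have h5 : (5 : ℝ) ∈ Icc (-5 : ℝ) 5 := by norm_num
  have h5' : (-5 : ℝ) ∈ Icc (-5 : ℝ) 5 := by norm_num
  have hlo : g (-5) ≤ h t := by
    rw [← hhT _ h5']
    exact hmono (by linarith [(abs_le.1 (hT _ h5')).2, ht.1])
  have hhi : h t ≤ g 5 := by
    rw [← hhT _ h5]
    exact hmono (by linarith [(abs_le.1 (hT _ h5)).1, ht.2])
  obtain ⟨τ, hτ, hgτ⟩ := intermediate_value_Icc (by norm_num : (-5 : ℝ) ≤ 5)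
    (fun s _ => (hg s).continuousAt.continuousWithinAt) ⟨hlo, hhi⟩
  have hTt : T (g τ) = t := by rw [hgτ, hTh t ⟨hlo, hhi⟩]
  have hτt : |t - τ| ≤ δ := by simpa [hTt] using hT τ hτ
  have hlip : |g t - g τ| ≤ M * |t - τ| := by
    simpa using convex_univ.norm_image_sub_le_of_norm_hasDerivWithin_le
      (fun s _ => (hg s).hasDerivWithinAt) (fun s _ => hg' s) (mem_univ τ) (mem_univ t)
  rw [← hgτ]
  exact hlip.trans (mul_le_mul_of_nonneg_left hτt hM)

lemma contDiffAt_profile {P P' h : ℝ → ℝ} {σ t₀ t₁ : ℝ}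
    (hleft : ∀ t ≤ t₀, h t = σ) (hright : ∀ t, t₁ ≤ t → h t = 1)
    (hode : ∀ t ∈ Ioo t₀ t₁, h t ∈ Ioo σ 1 ∧ HasDerivAt h (√(2 * P (h t))) t)
    (hP : ∀ s ∈ Ioo σ 1, HasDerivAt P (P' s) s) (hPpos : ∀ s ∈ Ioo σ 1, 0 < P s)
    (hP' : ContinuousOn P' (Ioo σ 1)) {t : ℝ} (h₀ : t ≠ t₀) (h₁ : t ≠ t₁) :
    ContDiffAt ℝ 2 h t := by
  rcases h₀.lt_or_gt with h₀ | h₀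
  · exact contDiffAt_const.congr_of_eventuallyEq
      (Filter.mem_of_superset (Iio_mem_nhds h₀) fun s hs => hleft s (le_of_lt hs))
  rcases h₁.lt_or_gt with h₁ | h₁
  · have hc : ContinuousOn h (Ioo t₀ t₁) := fun s hs =>
      (hode s hs).2.continuousAt.continuousWithinAt
    exact (contDiffOn_two_of_hasDerivAt isOpen_Ioo (fun s hs => (hode s hs).2)
      (fun s hs => hasDerivAt_sqrt_comp_of_ode (hP _ (hode s hs).1) (hPpos _ (hode s hs).1)
        (hode s hs).2)
      (hP'.comp hc fun s hs => (hode s hs).1)).contDiffAt (Ioo_mem_nhds h₀ h₁)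
  · exact contDiffAt_const.congr_of_eventuallyEq
      (Filter.mem_of_superset (Ioi_mem_nhds h₁) fun s hs => hright s (le_of_lt hs))

lemma viscSuperLap_of_touching {n : ℕ} {φ f : EuclideanSpace ℝ (Fin n) → ℝ}
    (H : ∀ x u, ContDiffAt ℝ 2 u x → (∀ y, u y ≤ φ y) → u x = φ x → lap n u x ≤ f x) :
    ViscSuperLap n φ f := fun x =>
  ⟨fun h => H x φ h (fun _ => le_rfl) rfl, fun _ ψ hψ heq hle => H x ψ hψ.contDiffAt hle heq⟩

/-- radial approximations: for all `R ≥ C` there is a nondecreasing, continuous,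
piecewise `C²` approximation `g_R` of the 1D solution `g`, constant outside `[-R/2, R/2]`, with
`g_R(0)=0`, `g_R(R/2)=1`, `|g-g_R| ≤ C/R` on `[-4,4]`, and such that `φ_R(x) = g_R(|x|-R)`
satisfies `Δφ_R ≤ W'(φ_R) + (C/R)χ_{B_{R+1}∖B_{R-1}}` in the viscosity sense. -/
theorem radial_approximations
    (n : ℕ) (hn : 1 ≤ n) (W : ℝ → ℝ) (hW : DoubleWell W)
    (g : ℝ → ℝ) (hg : IsOneDSolution W g) :
    ∃ C : ℝ, 0 < C ∧ ∀ R : ℝ, C ≤ R →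
      ∃ gR : ℝ → ℝ,
        (∀ t, gR t ∈ Set.Icc (-1:ℝ) 1) ∧
        Monotone gR ∧
        Continuous gR ∧
        (∃ S : Finset ℝ, ∀ t ∉ S, ContDiffAt ℝ 2 gR t) ∧
        (∀ t ≤ -(R/2), gR t = gR (-(R/2))) ∧
        (∀ t, R/2 ≤ t → gR t = 1) ∧
        gR 0 = 0 ∧ gR (R/2) = 1 ∧
        (∀ t ∈ Set.Icc (-4:ℝ) 4, |g t - gR t| ≤ C / R) ∧
        ViscSuperLap n (fun x => gR (‖x‖ - R))
          (fun x => deriv W (gR (‖x‖ - R)) +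
            (C / R) * Set.indicator (Metric.ball (0 : EuclideanSpace ℝ (Fin n)) (R+1) \
              Metric.ball 0 (R-1)) (fun _ => (1:ℝ)) x) := by
  obtain ⟨M, hM0, hM⟩ := hW.exists_speed_bound
  obtain ⟨m, a₀, hm, ha₀, hlin⟩ := hW.exists_linear_bound
  have hgmono : StrictMono g := strictMono_of_deriv_pos hg.2.2.2.1
  have hgI : ∀ t, g t ∈ Ioo (-1 : ℝ) 1 := hg.2.1
  have hg0 : g 0 = 0 := hg.2.2.2.2.1
  set a := min a₀ (g (-5))
  have ha : -1 < a := lt_min ha₀ (hgI _).1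
  have hag : a ≤ g (-5) := min_le_right _ _
  have ha0 : a < 0 := hag.trans_lt (hg0 ▸ hgmono (by norm_num))
  have hWa : ∀ s ∈ Ioc (-1 : ℝ) a, m * (s + 1) ≤ deriv W s ∧ deriv W s ≤ 1 :=
    fun s hs => hlin s ⟨hs.1, hs.2.trans (min_le_left _ _)⟩
  set d := g (1 / 2)
  have hd : 0 < d := hg0 ▸ hgmono (by norm_num)
  have hdb : d ≤ g 5 := hgmono.monotone (by norm_num)
  obtain ⟨w, hw, hWw⟩ := hW.exists_lower_bound ha (hgI 5).2
  have hn' : (1 : ℝ) ≤ n := by exact_mod_cast hn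
  obtain ⟨K, hK⟩ : ∃ K, K = 2 * n * M := ⟨_, rfl⟩
  have hK0 : 0 < K := by rw [hK]; positivity
  obtain ⟨B, hB⟩ : ∃ B, B = K + 1 + (K + 1) / m := ⟨_, rfl⟩
  have hB0 : 0 < B := by rw [hB]; positivity
  obtain ⟨Q, Q', L, hQ, hQ'c, hQb, hQneg, hQpos, hQ', hQL⟩ := exists_correction hK0.le hB0.le hd
  set q := B + K
  have hq : 0 < q := by positivity
  refine ⟨36 + q + 1 / w + 20 * (q / w) + |L| + M * (5 * (q / w)), by positivity, fun R hCR => ?_⟩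
  set C := 36 + q + 1 / w + 20 * (q / w) + |L| + M * (5 * (q / w))
  have hw1 : 0 < 1 / w := by positivity
  have hqw : 0 < q / w := by positivity
  have hMqw : 0 < M * (5 * (q / w)) := by positivity
  have hL0 := abs_nonneg L
  have hLC : L ≤ C := by linarith [le_abs_self L]
  have hC0 : 0 < C := by positivity
  have hR36 : 36 ≤ R := by linarith
  have hR : 0 < R := by linarith
  have hsqrt : 3 * √R ≤ R / 2 := by
    have h6 : 6 ≤ √R := Real.le_sqrt_of_sq_le (by linarith)
    nlinarith [Real.mul_self_sqrt hR.le]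
  have hQR : ∀ s ∈ Icc (-1 : ℝ) 1, |Q s / R| ≤ q / R := fun s hs => by
    rw [abs_div, abs_of_pos hR]
    gcongr
    exact hQb s hs
  have hqR1 : q / R ≤ 1 := (div_le_one hR).2 (by linarith)
  have hqRw : q / R ≤ w := by
    rw [div_le_iff₀ hR, ← div_le_iff₀' hw]
    linarith
  have hδ : q / R / w * 5 ≤ 1 / 4 := by
    rw [div_right_comm, div_mul_eq_mul_div, div_le_iff₀ hR]
    linarith
  have h1R : 1 / R ≤ w := by
    rw [div_le_iff₀ hR, ← div_le_iff₀' hw]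
    linarith
  set P : ℝ → ℝ := fun s => W s + Q s / R with hP_def
  set P' : ℝ → ℝ := fun s => deriv W s + Q' s / R with hP'_def
  have hPw : ∀ s ∈ Icc a (g 5), w ≤ P s := fun s hs => by
    have := (abs_le.1 (hQR s ⟨ha.le.trans hs.1, hs.2.trans (hgI 5).2.le⟩)).1
    have := hWw s hs
    simp only [hP_def]
    linarith
  obtain ⟨σ, ⟨hσ1, hσa⟩, hPσ, hlow⟩ := exists_zero_of_perturbed hW ha ha0 hm hWa hR hd hK0.le hB hQ
    hQneg hQpos (fun s hs => hQ' s (Or.inl hs))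
    (fun s hs => h1R.trans (hPw s ⟨hs.1, hs.2.trans hdb⟩))
  have hσ0 : σ < 0 := hσa.trans ha0
  have hσI : ∀ s ∈ Ico σ 1, s ∈ Ioo (-1 : ℝ) 1 := fun s hs => ⟨hσ1.trans_le hs.1, hs.2⟩
  have hPd : ∀ s ∈ Ico σ 1, HasDerivAt P (P' s) s := fun s hs =>
    (hW.hasDerivAt (hσI s hs)).add ((hQ s).div_const R)
  have hPpos : ∀ s ∈ Ioo σ 1, 0 < P s := fun s hs => by
    have := hlow s ⟨hs.1.le, hs.2.le⟩
    have : 0 < (s - σ) / R := div_pos (sub_pos.2 hs.1) hR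
    simp only [hP_def]
    linarith
  have hPM : ∀ s ∈ Ioo σ 1, √(2 * P s) ≤ M := fun s hs => by
    have hs' : s ∈ Icc (-1 : ℝ) 1 := ⟨(hσ1.trans hs.1).le, hs.2.le⟩
    refine le_trans (Real.sqrt_le_sqrt ?_) (hM s hs')
    have := (abs_le.1 (hQR s hs')).2
    simp only [hP_def]
    linarith
  have hP'c : ContinuousOn P' (Ioo σ 1) := fun s hs =>
    ((hW.continuousAt_deriv (hσI s ⟨hs.1.le, hs.2⟩)).add
      (hQ'c.continuousAt.div_const R)).continuousWithinAt
  obtain ⟨h, T, t₀, t₁, ht₀, ht₁, ht₀R, ht₁R, hmono, hc, hleft, hright, hode, hT, hh0, hT0⟩ :=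
    exists_profile hσ0 hσ1.le hR
      (fun s hs => (hPd s ⟨hs.1.le, hs.2⟩).continuousAt.continuousWithinAt)
      (fun s hs => hlow s ⟨hs.1.le, hs.2.le⟩)
  have hThI : ∀ t, h t ∈ Ioo σ 1 → T (h t) = t := fun t ht => by
    refine (hode t ⟨?_, ?_⟩).2.1
    · by_contra! hle
      exact ht.1.ne' (hleft t hle)
    · by_contra! hle
      exact ht.2.ne (hright t hle)
  have hh1 : ∀ t, h t ≤ 1 := fun t => by
    rw [← hright (max t t₁) (le_max_right _ _)]
    exact hmono (le_max_left _ _)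
  have hhσ : ∀ t, σ ≤ h t := fun t => by
    rw [← hleft (min t t₀) (min_le_right _ _)]
    exact hmono (min_le_left _ _)
  have hg5 : ∀ t ∈ Icc (-5 : ℝ) 5, g t ∈ Icc a (g 5) := fun t ht =>
    ⟨hag.trans (hgmono.monotone ht.1), hgmono.monotone ht.2⟩
  have hbI : ∀ s ∈ Icc a (g 5), s ∈ Ioo σ 1 := fun s hs =>
    ⟨hσa.trans_le hs.1, hs.2.trans_lt (hgI 5).2⟩
  have hgT : ∀ t ∈ Icc (-5 : ℝ) 5, |T (g t) - t| ≤ q / R / w * 5 := by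
    refine abs_travel_time_sub_le (U := W) (P := P) hw (hg.hasDerivAt_sqrt hW)
      (fun t _ => hW.nonneg (Ioo_subset_Icc_self (hgI t))) (fun t ht => hPw _ (hg5 t ht))
      (fun t _ => ?_) (fun t ht => (hT _ (hbI _ (hg5 t ht))).2) (by rw [hg0, hT0])
    have := hQR _ (Ioo_subset_Icc_self (hgI t))
    rwa [← abs_neg, show -(W (g t) - P (g t)) = Q (g t) / R by simp [hP_def]]
  refine ⟨h, fun t => ⟨hσ1.le.trans (hhσ t), hh1 t⟩, hmono, hc, ⟨{t₀, t₁}, fun t ht => ?_⟩, ?_,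
    fun t ht => hright t (by linarith), hh0, hright _ (by linarith), fun t ht => ?_,
    viscSuperLap_of_touching fun x u hu hux heq => ?_⟩
  · simp only [Finset.mem_insert, Finset.mem_singleton, not_or] at ht
    exact contDiffAt_profile hleft hright (fun s hs => ⟨(hode s hs).1, (hode s hs).2.2⟩)
      (fun s hs => hPd s ⟨hs.1.le, hs.2⟩) hPpos hP'c ht.1 ht.2
  · intro t ht
    rw [hleft t (by linarith), hleft _ (by linarith)]
  · refine (abs_sub_le_of_travel_time hM0.le (hg.hasDerivAt_sqrt hW) (fun s => ?_) hmono
      (fun τ hτ => (hT _ (hbI _ (hg5 τ hτ))).1) hgT (by linarith)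
      (fun s hs => hThI s (hbI _ ⟨hag.trans hs.1, hs.2⟩)) t ht).trans ?_
    · rw [abs_of_nonneg (Real.sqrt_nonneg _)]
      exact (Real.sqrt_le_sqrt (by linarith)).trans (hM _ (Ioo_subset_Icc_self (hgI s)))
    · rw [div_right_comm, div_mul_eq_mul_div, mul_div_assoc', mul_comm (q / w)]
      gcongr
      linarith
  · set χ := Set.indicator (Metric.ball (0 : EuclideanSpace ℝ (Fin n)) (R + 1) \
      Metric.ball 0 (R - 1)) (fun _ => (1 : ℝ)) x
    have hχ0 : 0 ≤ C / R * χ :=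
      mul_nonneg (by positivity) (indicator_nonneg (fun _ _ => zero_le_one) _)
    refine lap_le_of_touching_profile (M := M) hR (ht₀.trans ht₁) (by linarith) hc hh1 hleft hright
      (fun s hs => ⟨(hode s hs).1, (hode s hs).2.2⟩) hPd (by linarith) hPσ hPpos hPM hu hux heq
      (fun ht => ?_) (fun ht => ?_) (fun ht => ?_)
    · obtain ⟨hI, hTt, -⟩ := hode _ ht
      set t := ‖x‖ - R
      rw [← hK, show P' (h t) + K / R = deriv W (h t) + (Q' (h t) + K) / R by
        simp only [hP'_def]; ring]
      gcongr
      rcases em (h t < 0 ∨ d < h t) with hout | hin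
      · rw [hQ' _ hout]
        simpa using hχ0
      · push Not at hin
        have ht0 : 0 ≤ t := by
          by_contra! hneg
          have h00 : h t = 0 := le_antisymm (hh0 ▸ hmono hneg.le) hin.1
          rw [h00, hT0] at hTt
          exact hneg.ne hTt.symm
        have ht1 : t < 1 := by
          by_contra! hge
          have hTd := (abs_le.1 (hgT (1 / 2) (by norm_num))).2
          have hdI : d ∈ Ioo σ 1 := hbI _ (hg5 _ (by norm_num))
          have hdt : d ≤ h t := (hT d hdI).1.symm.le.trans (hmono (by linarith))
          rw [le_antisymm hin.2 hdt] at hTt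
          linarith
        have hx : x ∈ Metric.ball (0 : EuclideanSpace ℝ (Fin n)) (R + 1) \
            Metric.ball 0 (R - 1) := by
          constructor <;> rw [mem_ball_zero_iff] <;> linarith
        have hχ1 : χ = 1 := indicator_of_mem hx _
        rw [hχ1, mul_one]
        gcongr
        exact (hQL _ ⟨(hσ1.trans hI.1).le, hI.2.le⟩).trans hLC
    · have hKR : 0 < K / R := by positivity
      rw [hleft _ ht.le]
      simp only [hP'_def, hQ' σ (Or.inl hσ0), neg_div]
      linarith
    · rcases ht with ht | ht
      · have := (hWa σ ⟨hσ1, hσa.le⟩).1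
        have : 0 < m * (σ + 1) := mul_pos hm (by linarith)
        rw [hleft _ ht]
        linarith
      · rw [hright _ ht, hW.2.2.2.2.2.1, zero_add]
        exact hχ0

end
end

section
/- Let C₀ > 0 and for R > 0 let g_R : ℝ → [-1,1] be nondecreasing, constant on (-∞,-R/2] and on [R/2,∞), with g_R(0)=0 and |g - g_R| ≤ C₀/R on [-4,4], and such that φ_R(x) := g_R(|x|-R) satisfies Δφ_R ≤ W'(φ_R) + (C₀/R)·χ_{B_{R+1}(0)\B_{R-1}(0)} in the viscosity sense on ℝⁿ. Let u : ℝⁿ → (-1,1) be a C² solution of Δu = W'(u) in ℝⁿ with φ_R ≥ u on ℝⁿ. For every K > 0 there exists C(K), depending only on n, W, C₀ and K, such that for all sufficiently large R the following holds: if u(y) ≥ φ_R(y) - K/R at some point y in the annulus B_{R+1}(0)\B_{R-1}(0), then, setting π(y) := R·y/|y| and ν := π(y)/R, in B₁(π(y)): (1) {u=0} ∩ B₁(π(y)) is the graph in the direction ν of a C² function with second derivatives bounded by C(K)/R, lying within distance C(K)/R of ∂B_R(0); (2) |u(x) - g(x·ν - R)| ≤ C(K)/R for every x ∈ B₁(π(y)).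 -/
open MeasureTheory Metric Set Filter RealInnerProductSpace

noncomputable section

abbrev Euc (n : ℕ) := EuclideanSpace ℝ (Fin n)

/-- The truncated paraboloid `(1 - |z|²)₊`. -/
def paraboloid {n : ℕ} (z : Euc n) : ℝ := max (1 - ‖z‖ ^ 2) 0

/-- A `C¹` bump whose gradient is `-z (1 - |z|²)₊`. -/
def quartic {n : ℕ} (z : Euc n) : ℝ := paraboloid z ^ 2 / 4

section Kernel

variable {n : ℕ}

lemma paraboloid_nonneg (z : Euc n) : 0 ≤ paraboloid z := le_max_right _ _

lemma paraboloid_le_one (z : Euc n) : paraboloid z ≤ 1 :=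
  max_le (by nlinarith [sq_nonneg ‖z‖]) zero_le_one

lemma continuous_paraboloid : Continuous (paraboloid (n := n)) := by
  unfold paraboloid; fun_prop

lemma paraboloid_eq_zero {z : Euc n} (hz : 1 ≤ ‖z‖) : paraboloid z = 0 :=
  max_eq_right (by nlinarith)

lemma paraboloid_eq {z : Euc n} (hz : ‖z‖ ≤ 1) : paraboloid z = 1 - ‖z‖ ^ 2 :=
  max_eq_left (by nlinarith [norm_nonneg z])

lemma norm_lt_one_of_paraboloid_ne_zero {z : Euc n} (hz : paraboloid z ≠ 0) : ‖z‖ < 1 := by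
  by_contra! h
  exact hz (paraboloid_eq_zero h)

lemma hasCompactSupport_paraboloid : HasCompactSupport (paraboloid (n := n)) :=
  HasCompactSupport.intro (isCompact_closedBall 0 1) fun z hz => by
    apply paraboloid_eq_zero
    simp only [mem_closedBall, dist_zero_right, not_le] at hz
    exact hz.le

lemma abs_paraboloid_sub_le (z z' : Euc n) : |paraboloid z - paraboloid z'| ≤ 2 * ‖z - z'‖ := by
  have key : ∀ a : Euc n, paraboloid a = 1 - (min ‖a‖ 1) ^ 2 := by
    intro a
    rcases le_total ‖a‖ 1 with h | h
    · rw [paraboloid_eq h, min_eq_left h]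
    · rw [paraboloid_eq_zero h, min_eq_right h]; norm_num
  have h1 : |min ‖z‖ 1 - min ‖z'‖ 1| ≤ ‖z - z'‖ :=
    (abs_inf_sub_inf_le_abs _ _ _).trans (abs_norm_sub_norm_le z z')
  have h2 : |min ‖z‖ 1 + min ‖z'‖ 1| ≤ 2 := by
    rw [abs_of_nonneg (by positivity)]
    linarith [min_le_right ‖z‖ 1, min_le_right ‖z'‖ 1]
  rw [key, key, show 1 - min ‖z‖ 1 ^ 2 - (1 - min ‖z'‖ 1 ^ 2) =
    -((min ‖z‖ 1 + min ‖z'‖ 1) * (min ‖z‖ 1 - min ‖z'‖ 1)) by ring, abs_neg, abs_mul]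
  gcongr

lemma continuous_quartic : Continuous (quartic (n := n)) := by
  unfold quartic
  exact (continuous_paraboloid.pow 2).div_const 4

lemma quartic_nonneg (z : Euc n) : 0 ≤ quartic z := by unfold quartic; positivity

lemma quartic_le (z : Euc n) : quartic z ≤ paraboloid z := by
  have := paraboloid_nonneg z
  have := paraboloid_le_one z
  unfold quartic
  nlinarith

lemma quartic_eq_zero {z : Euc n} (hz : 1 ≤ ‖z‖) : quartic z = 0 := by
  simp [quartic, paraboloid_eq_zero hz]

lemma hasCompactSupport_quartic : HasCompactSupport (quartic (n := n)) :=
  HasCompactSupport.intro (isCompact_closedBall 0 1) fun z hz => by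
    apply quartic_eq_zero
    simp only [mem_closedBall, dist_zero_right, not_le] at hz
    exact hz.le

lemma abs_quartic_sub_le (z z' : Euc n) : |quartic z - quartic z'| ≤ 2 * ‖z - z'‖ := by
  have h1 := abs_paraboloid_sub_le z z'
  have h2 : |(paraboloid z + paraboloid z') / 4| ≤ 1 := by
    rw [abs_of_nonneg (by linarith [paraboloid_nonneg z, paraboloid_nonneg z'])]
    linarith [paraboloid_le_one z, paraboloid_le_one z']
  rw [quartic, quartic, show paraboloid z ^ 2 / 4 - paraboloid z' ^ 2 / 4 =
    (paraboloid z + paraboloid z') / 4 * (paraboloid z - paraboloid z') by ring, abs_mul]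
  nlinarith [abs_nonneg (paraboloid z - paraboloid z')]

lemma hasDerivAt_max_zero_sq (s : ℝ) : HasDerivAt (fun t : ℝ => max t 0 ^ 2) (2 * max s 0) s := by
  rcases lt_trichotomy s 0 with h | h | h
  · rw [max_eq_right h.le]
    have : (fun t : ℝ => max t 0 ^ 2) =ᶠ[nhds s] fun _ => 0 := by
      filter_upwards [Iio_mem_nhds h] with t ht
      simp [max_eq_right (mem_Iio.1 ht).le]
    simpa using (hasDerivAt_const s (0:ℝ)).congr_of_eventuallyEq this
  · subst h
    rw [hasDerivAt_iff_isLittleO]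
    simp only [max_self, sub_zero, mul_zero, smul_eq_mul, ne_eq, OfNat.ofNat_ne_zero,
      not_false_eq_true, zero_pow]
    refine Asymptotics.IsBigO.trans_isLittleO (g := fun t : ℝ => t ^ 2) ?_ ?_
    · refine Asymptotics.IsBigO.of_bound 1 (Eventually.of_forall fun t => ?_)
      rcases le_total t 0 with ht | ht
      · simp [max_eq_right ht, sq_nonneg]
      · simp [max_eq_left ht]
    · simpa using Asymptotics.isLittleO_pow_pow (𝕜 := ℝ) (m := 1) (n := 2) (by norm_num)
  · rw [max_eq_left h.le]
    have : (fun t : ℝ => max t 0 ^ 2) =ᶠ[nhds s] fun t => t ^ 2 := by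
      filter_upwards [Ioi_mem_nhds h] with t ht
      rw [max_eq_left (mem_Ioi.1 ht).le]
    simpa using (hasDerivAt_pow 2 s).congr_of_eventuallyEq this

lemma hasFDerivAt_quartic (z : Euc n) :
    HasFDerivAt quartic (-(paraboloid z) • innerSL ℝ z) z := by
  have h1 : HasFDerivAt (fun z : Euc n => 1 - ‖z‖ ^ 2) (-(2 • innerSL ℝ z)) z :=
    (hasStrictFDerivAt_norm_sq z).hasFDerivAt.const_sub 1
  have h2 := ((hasDerivAt_max_zero_sq (1 - ‖z‖ ^ 2)).comp_hasFDerivAt z h1).const_mul (1/4 : ℝ)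
  have h3 : (fun y : Euc n => 1 / 4 * ((fun t : ℝ => max t 0 ^ 2) ∘ fun z : Euc n => 1 - ‖z‖ ^ 2) y)
      = quartic := by
    funext y
    simp only [quartic, paraboloid, Function.comp_apply]; ring
  rw [h3] at h2
  refine h2.congr_fderiv ?_
  ext v
  simp [paraboloid]
  ring

lemma fderiv_quartic_apply (z v : Euc n) :
    fderiv ℝ quartic z v = -(paraboloid z * ⟪z, v⟫) := by
  rw [(hasFDerivAt_quartic z).fderiv]; simp

lemma integrable_paraboloid : Integrable (paraboloid (n := n)) :=
  continuous_paraboloid.integrable_of_hasCompactSupport hasCompactSupport_paraboloid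

lemma integral_paraboloid_pos : 0 < ∫ z : Euc n, paraboloid z := by
  refine continuous_paraboloid.integral_pos_of_hasCompactSupport_nonneg_nonzero
    hasCompactSupport_paraboloid paraboloid_nonneg (x := 0) ?_
  simp [paraboloid]

/-- Weighted averages of `w` at scale `r`. -/
def weightedMean (w : Euc n → ℝ) (x : Euc n) (r : ℝ) : ℝ :=
  ∫ z : Euc n, w (x + r • z) * paraboloid z

lemma integrable_mul_of_hasCompactSupport {F κ : Euc n → ℝ} (hF : Continuous F) (hκ : Continuous κ)
    (hs : HasCompactSupport κ) : Integrable fun z => F z * κ z :=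
  (hF.mul hκ).integrable_of_hasCompactSupport (hs.mul_left)

lemma sum_apply_single_mul (L : Euc n →L[ℝ] ℝ) (z : Euc n) :
    ∑ i, L (EuclideanSpace.single i 1) * ⟪z, EuclideanSpace.single i (1:ℝ)⟫ = L z := by
  have h := (EuclideanSpace.basisFun (Fin n) ℝ).sum_repr z
  conv_rhs => rw [← h]
  rw [map_sum]
  refine Finset.sum_congr rfl fun i _ => ?_
  simp [EuclideanSpace.inner_single_right, mul_comm]

lemma continuous_lap {w : Euc n → ℝ} (hw : ContDiff ℝ 2 w) : Continuous (lap n w) := by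
  unfold lap
  refine continuous_finsetSum _ fun i _ => ?_
  have h1 : ContDiff ℝ 1 fun y => fderiv ℝ w y (EuclideanSpace.single i 1) :=
    (hw.fderiv_right (m := 1) (by norm_num)).clm_apply contDiff_const
  exact (h1.continuous_fderiv (by norm_num)).clm_apply continuous_const

lemma integral_fderiv_mul_paraboloid {w : Euc n → ℝ} (hw : ContDiff ℝ 2 w) (x : Euc n) (s : ℝ) :
    ∫ z : Euc n, fderiv ℝ w (x + s • z) z * paraboloid z =
      s * ∫ z : Euc n, lap n w (x + s • z) * quartic z := by
  have hD (i : Fin n) : ContDiff ℝ 1 fun y => fderiv ℝ w y (EuclideanSpace.single i 1) :=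
    (hw.fderiv_right (m := 1) (by norm_num)).clm_apply contDiff_const
  have hDD (i : Fin n) : Continuous fun z : Euc n =>
      fderiv ℝ (fun y => fderiv ℝ w y (EuclideanSpace.single i 1)) (x + s • z)
        (EuclideanSpace.single i 1) :=
    (((hD i).continuous_fderiv (by norm_num)).clm_apply continuous_const).comp
      (by fun_prop : Continuous fun z : Euc n => x + s • z)
  have hf (i : Fin n) (z : Euc n) :
      HasFDerivAt (fun z : Euc n => fderiv ℝ w (x + s • z) (EuclideanSpace.single i 1))
        (s • fderiv ℝ (fun y => fderiv ℝ w y (EuclideanSpace.single i 1)) (x + s • z)) z := by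
    have h1 : HasFDerivAt (fun z : Euc n => x + s • z) (s • ContinuousLinearMap.id ℝ (Euc n)) z :=
      ((hasFDerivAt_id z).const_smul s).const_add x
    have h2 := (((hD i).differentiable (by norm_num)) (x + s • z)).hasFDerivAt.comp z h1
    rw [ContinuousLinearMap.comp_smul, ContinuousLinearMap.comp_id] at h2
    exact h2
  have hparts (i : Fin n) :
      ∫ z : Euc n, fderiv ℝ w (x + s • z) (EuclideanSpace.single i 1) *
          (paraboloid z * ⟪z, EuclideanSpace.single i (1:ℝ)⟫) =
        s * ∫ z : Euc n, fderiv ℝ (fun y => fderiv ℝ w y (EuclideanSpace.single i 1)) (x + s • z)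
        (EuclideanSpace.single i 1) * quartic z := by
    have hcf : Continuous fun z : Euc n => fderiv ℝ w (x + s • z) (EuclideanSpace.single i 1) :=
      (hD i).continuous.comp (by fun_prop : Continuous fun z : Euc n => x + s • z)
    have hcη : Continuous fun z : Euc n => paraboloid z * ⟪z, EuclideanSpace.single i (1:ℝ)⟫ :=
      continuous_paraboloid.mul (by fun_prop)
    have := integral_mul_fderiv_eq_neg_fderiv_mul_of_integrable (μ := volume)
      (f := fun z : Euc n => fderiv ℝ w (x + s • z) (EuclideanSpace.single i 1))
      (g := quartic) (v := EuclideanSpace.single i 1) ?_ ?_ ?_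
      (fun z _ => (hf i z).differentiableAt) (fun z _ => (hasFDerivAt_quartic z).differentiableAt)
    · simp only [fderiv_quartic_apply, mul_neg, integral_neg, neg_inj] at this
      rw [this, ← integral_const_mul]
      refine integral_congr_ae (Eventually.of_forall fun z => ?_)
      simp only [(hf i z).fderiv]
      simp [mul_assoc]
    · simp only [(hf i _).fderiv]
      exact integrable_mul_of_hasCompactSupport ((hDD i).const_smul s) continuous_quartic
        hasCompactSupport_quartic
    · simp only [fderiv_quartic_apply]
      exact integrable_mul_of_hasCompactSupport hcf hcη.neg
        (hasCompactSupport_paraboloid.mul_right.neg)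
    · exact integrable_mul_of_hasCompactSupport hcf continuous_quartic hasCompactSupport_quartic
  calc _ = ∫ z : Euc n, ∑ i, fderiv ℝ w (x + s • z) (EuclideanSpace.single i 1) *
          (paraboloid z * ⟪z, EuclideanSpace.single i (1:ℝ)⟫) := by
        refine integral_congr_ae (Eventually.of_forall fun z => ?_)
        simp only
        rw [← sum_apply_single_mul (fderiv ℝ w (x + s • z)) z, Finset.sum_mul]
        exact Finset.sum_congr rfl fun i _ => by ring
    _ = _ := by
        rw [integral_finsetSum]
        · simp only [hparts]
          rw [← Finset.mul_sum, ← integral_finsetSum]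
          · simp only [lap, Finset.sum_mul]
          · exact fun i _ => integrable_mul_of_hasCompactSupport (hDD i) continuous_quartic
              hasCompactSupport_quartic
        · intro i _
          refine integrable_mul_of_hasCompactSupport
            ((hD i).continuous.comp (by fun_prop : Continuous fun z : Euc n => x + s • z))
            (continuous_paraboloid.mul (by fun_prop)) hasCompactSupport_paraboloid.mul_right

lemma hasDerivAt_weightedMean {w : Euc n → ℝ} (hw : ContDiff ℝ 2 w) (x : Euc n) (s : ℝ) :
    HasDerivAt (weightedMean w x) (s * ∫ z : Euc n, lap n w (x + s • z) * quartic z) s := by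
  rw [← integral_fderiv_mul_paraboloid hw]
  have hDw : Continuous (fderiv ℝ w) := hw.continuous_fderiv (by norm_num)
  obtain ⟨B, hB⟩ := ((isCompact_closedBall s 1).prod (isCompact_closedBall (0 : Euc n) 1)).exists_bound_of_continuousOn
    (f := fun q : ℝ × Euc n => fderiv ℝ w (x + q.1 • q.2) q.2) (by fun_prop)
  refine (hasDerivAt_integral_of_dominated_loc_of_deriv_le (μ := volume)
    (F := fun r z => w (x + r • z) * paraboloid z)
    (F' := fun r z => fderiv ℝ w (x + r • z) z * paraboloid z)
    (bound := fun z => B * paraboloid z) (ball_mem_nhds s one_pos) ?_ ?_ ?_ ?_ ?_ ?_).2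
  · refine Eventually.of_forall fun r => ?_
    exact ((hw.continuous.comp (by fun_prop)).mul continuous_paraboloid).aestronglyMeasurable
  · exact integrable_mul_of_hasCompactSupport (hw.continuous.comp (by fun_prop))
      continuous_paraboloid hasCompactSupport_paraboloid
  · refine Continuous.aestronglyMeasurable (Continuous.mul ?_ continuous_paraboloid)
    fun_prop
  · refine Eventually.of_forall fun z r hr => ?_
    rw [norm_mul, Real.norm_of_nonneg (paraboloid_nonneg z)]
    by_cases hz : paraboloid z = 0
    · simp [hz]
    · refine mul_le_mul_of_nonneg_right (hB (r, z) ⟨ball_subset_closedBall hr, ?_⟩)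
        (paraboloid_nonneg z)
      simpa using (norm_lt_one_of_paraboloid_ne_zero hz).le
  · exact integrable_paraboloid.const_mul B
  · refine Eventually.of_forall fun z r _ => ?_
    have h1 : HasDerivAt (fun r : ℝ => x + r • z) z r := by
      simpa using ((hasDerivAt_id r).smul_const z).const_add x
    exact ((hw.differentiable (by norm_num) _).hasFDerivAt.comp_hasDerivAt r h1).mul_const _

lemma weightedMean_zero (w : Euc n → ℝ) (x : Euc n) :
    weightedMean w x 0 = w x * ∫ z : Euc n, paraboloid z := by
  simp [weightedMean, integral_const_mul]

end Kernel

section InteriorEstimates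

variable {n : ℕ}

lemma abs_integral_translate_sub_le {F κ : Euc n → ℝ} (hF : Continuous F) (hκ : Continuous κ)
    (hlip : ∀ z z', |κ z - κ z'| ≤ 2 * ‖z - z'‖) (hzero : ∀ z : Euc n, 1 ≤ ‖z‖ → κ z = 0)
    {x x' : Euc n} {s B : ℝ} (hs : 0 < s) (hB : ∀ ξ ∈ ball x s, |F ξ| ≤ B)
    (hB' : ∀ ξ ∈ ball x' s, |F ξ| ≤ B) :
    |(∫ z, F (x' + s • z) * κ z) - ∫ z, F (x + s • z) * κ z| ≤
      B * (4 * volume.real (ball (0 : Euc n) 1)) * (‖x' - x‖ / s) := by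
  have hB0 : 0 ≤ B := (abs_nonneg _).trans (hB x (mem_ball_self hs))
  have hsupp : HasCompactSupport κ := HasCompactSupport.intro (isCompact_closedBall 0 1) fun z hz =>
    hzero z (by simp only [mem_closedBall, dist_zero_right, not_le] at hz; exact hz.le)
  set a : Euc n := s⁻¹ • (x' - x) with ha
  have hsa : s • a = x' - x := by rw [ha, smul_inv_smul₀ hs.ne']
  have hshift : (∫ z, F (x' + s • z) * κ z) = ∫ z, F (x + s • z) * κ (z - a) := by
    rw [← integral_add_right_eq_self (fun z => F (x + s • z) * κ (z - a)) a]
    refine integral_congr_ae (Eventually.of_forall fun z => ?_)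
    simp only [smul_add, hsa, add_sub_cancel_right]
    congr 2
    abel
  have hc : Continuous fun z : Euc n => F (x + s • z) := hF.comp (by fun_prop)
  have hi1 : Integrable fun z => F (x + s • z) * κ (z - a) := by
    refine integrable_mul_of_hasCompactSupport hc (hκ.comp (by fun_prop)) ?_
    exact hsupp.comp_homeomorph (Homeomorph.subRight a)
  have hi2 : Integrable fun z => F (x + s • z) * κ z :=
    integrable_mul_of_hasCompactSupport hc hκ hsupp
  rw [hshift, ← integral_sub hi1 hi2]
  have hna : ‖a‖ = ‖x' - x‖ / s := by
    rw [ha, norm_smul, norm_inv, Real.norm_of_nonneg hs.le]; field_simp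
  have hind (c : Euc n) : Integrable ((ball c 1).indicator fun _ => (1 : ℝ)) :=
    (integrable_indicator_iff measurableSet_ball).2 (integrableOn_const measure_ball_lt_top.ne)
  have hbound := norm_integral_le_of_norm_le (μ := volume)
    (f := fun z => F (x + s • z) * κ (z - a) - F (x + s • z) * κ z)
    (g := fun z => B * (2 * ‖a‖) * ((ball a 1).indicator (fun _ => (1 : ℝ)) z +
      (ball (0 : Euc n) 1).indicator (fun _ => (1 : ℝ)) z))
    (((hind a).add (hind 0)).const_mul _) (Eventually.of_forall fun z => ?_)
  · rw [Real.norm_eq_abs] at hbound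
    refine hbound.trans_eq ?_
    rw [integral_const_mul, integral_add (hind a) (hind 0), integral_indicator_const _
      measurableSet_ball, integral_indicator_const _ measurableSet_ball, hna]
    have : volume.real (ball a 1) = volume.real (ball (0 : Euc n) 1) := by
      simp only [Measure.real, Measure.addHaar_ball_center]
    rw [this]
    simp only [smul_eq_mul, mul_one]
    ring
  · have hk : |κ (z - a) - κ z| ≤ 2 * ‖a‖ := by
      have := hlip (z - a) z
      rwa [show z - a - z = -a by abel, norm_neg] at this
    rw [← mul_sub, norm_mul, Real.norm_eq_abs, Real.norm_eq_abs]
    have hn1 : (0 : ℝ) ≤ (ball a 1).indicator (fun _ => (1 : ℝ)) z :=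
      indicator_nonneg (fun _ _ => zero_le_one) _
    have hn2 : (0 : ℝ) ≤ (ball (0 : Euc n) 1).indicator (fun _ => (1 : ℝ)) z :=
      indicator_nonneg (fun _ _ => zero_le_one) _
    have main (hFz : |F (x + s • z)| ≤ B) (h1 : 1 ≤ (ball a 1).indicator (fun _ => (1 : ℝ)) z +
        (ball (0 : Euc n) 1).indicator (fun _ => (1 : ℝ)) z) :
        |F (x + s • z)| * |κ (z - a) - κ z| ≤ B * (2 * ‖a‖) *
          ((ball a 1).indicator (fun _ => (1 : ℝ)) z +
            (ball (0 : Euc n) 1).indicator (fun _ => (1 : ℝ)) z) :=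
      (mul_le_mul hFz hk (abs_nonneg _) hB0).trans
        (le_mul_of_one_le_right (by positivity) h1)
    by_cases hz0 : z ∈ ball (0 : Euc n) 1
    · refine main (hB _ ?_) (by rw [indicator_of_mem hz0]; linarith)
      rw [mem_ball_zero_iff] at hz0
      rw [mem_ball, dist_eq_norm, add_sub_cancel_left, norm_smul, Real.norm_of_nonneg hs.le]
      nlinarith
    · by_cases hza : z ∈ ball a 1
      · refine main (hB' _ ?_) (by rw [indicator_of_mem hza]; linarith)
        rw [mem_ball, dist_eq_norm] at hza
        rw [mem_ball, dist_eq_norm, show x + s • z - x' = s • (z - a) by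
          rw [smul_sub, hsa]; abel, norm_smul, Real.norm_of_nonneg hs.le]
        nlinarith
      · rw [hzero z (by simpa using hz0), hzero (z - a) (by simpa [dist_eq_norm] using hza)]
        simp only [sub_zero, abs_zero, mul_zero]
        positivity

/-- The constant in the interior Lipschitz estimate. -/
def lipConst (n : ℕ) : ℝ := 4 * volume.real (ball (0 : Euc n) 1) / ∫ z : Euc n, paraboloid z

lemma lipConst_nonneg (n : ℕ) : 0 ≤ lipConst n := by
  have := integral_paraboloid_pos (n := n)
  unfold lipConst; positivity

/-- Interior Lipschitz estimate for Poisson's equation. -/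
lemma abs_sub_le_of_abs_lap_le {w : Euc n → ℝ} (hw : ContDiff ℝ 2 w) {p : Euc n} {ρ r A B : ℝ}
    (hr : 0 < r) (hA : ∀ x ∈ ball p (ρ + r), |w x| ≤ A) (hB : ∀ x ∈ ball p (ρ + r), |lap n w x| ≤ B)
    {x x' : Euc n} (hx : x ∈ ball p ρ) (hx' : x' ∈ ball p ρ) :
    |w x' - w x| ≤ lipConst n * (A / r + B * r) * ‖x' - x‖ := by
  have hsub {q : Euc n} (hq : q ∈ ball p ρ) {s : ℝ} (hs : s ≤ r) : ball q s ⊆ ball p (ρ + r) := by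
    refine ball_subset_ball' ?_
    rw [mem_ball] at hq
    linarith
  set V := 4 * volume.real (ball (0 : Euc n) 1) with hV
  have hV0 : 0 ≤ V := by positivity
  have hI := integral_paraboloid_pos (n := n)
  set I := ∫ z : Euc n, paraboloid z
  have hB0 : 0 ≤ B := (abs_nonneg _).trans (hB x (hsub hx le_rfl (mem_ball_self hr)))
  have hend : |weightedMean w x' r - weightedMean w x r| ≤ A * V * (‖x' - x‖ / r) :=
    abs_integral_translate_sub_le hw.continuous continuous_paraboloid abs_paraboloid_sub_le
      (fun z => paraboloid_eq_zero) hr (fun ξ hξ => hA ξ (hsub hx le_rfl hξ))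
      (fun ξ hξ => hA ξ (hsub hx' le_rfl hξ))
  have hder (s : ℝ) := (hasDerivAt_weightedMean hw x' s).sub (hasDerivAt_weightedMean hw x s)
  have hmean := (convex_Icc (0 : ℝ) r).norm_image_sub_le_of_norm_hasDerivWithin_le
    (f := fun s => weightedMean w x' s - weightedMean w x s) (C := B * V * ‖x' - x‖)
    (fun s _ => (hder s).hasDerivWithinAt) (fun s hs => ?_)
    (left_mem_Icc.2 hr.le) (right_mem_Icc.2 hr.le)
  · rw [weightedMean_zero, weightedMean_zero, ← sub_mul, Real.norm_eq_abs, sub_zero,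
      Real.norm_of_nonneg hr.le] at hmean
    have h1 : |(w x' - w x) * I| ≤ V * (A / r + B * r) * ‖x' - x‖ := by
      have := abs_sub_abs_le_abs_sub ((w x' - w x) * I) (weightedMean w x' r - weightedMean w x r)
      rw [abs_sub_comm] at hmean
      have e : A * V * (‖x' - x‖ / r) = V * (A / r) * ‖x' - x‖ := by ring
      nlinarith
    rw [abs_mul, abs_of_pos hI, ← le_div_iff₀ hI] at h1
    refine h1.trans_eq ?_
    simp only [lipConst]
    ring
  · rcases hs.1.eq_or_lt with h0 | h0
    · simp only [← h0, zero_mul, sub_zero, norm_zero]; positivity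
    · have := abs_integral_translate_sub_le (continuous_lap hw) continuous_quartic
        abs_quartic_sub_le (fun z => quartic_eq_zero) h0 (fun ξ hξ => hB ξ (hsub hx hs.2 hξ))
        (fun ξ hξ => hB ξ (hsub hx' hs.2 hξ))
      rw [← mul_sub, norm_mul, Real.norm_of_nonneg hs.1, Real.norm_eq_abs]
      refine (mul_le_mul_of_nonneg_left this hs.1).trans_eq ?_
      rw [hV]
      field_simp

lemma add_smul_mem_ball {x z : Euc n} {ρ s : ℝ} (hρ : 0 < ρ) (hs : s ∈ Icc 0 ρ) (hz : ‖z‖ < 1) :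
    x + s • z ∈ ball x ρ := by
  rw [mem_ball, dist_eq_norm, add_sub_cancel_left, norm_smul, Real.norm_of_nonneg hs.1]
  nlinarith [hs.1, hs.2, norm_nonneg z]

lemma weightedMean_comparison {w : Euc n → ℝ} (hw : ContDiff ℝ 2 w) {x : Euc n} {ρ L : ℝ}
    (hρ : 0 < ρ) (hρ1 : ρ ≤ 1) (hL : 0 ≤ L) (hpos : ∀ ξ ∈ ball x ρ, 0 ≤ w ξ)
    (hlap : ∀ ξ ∈ ball x ρ, |lap n w ξ| ≤ L * w ξ) :
    weightedMean w x ρ ≤ Real.exp L * weightedMean w x 0 ∧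
      weightedMean w x 0 ≤ Real.exp L * weightedMean w x ρ := by
  have hmul_nonneg {s : ℝ} (hs : s ∈ Icc 0 ρ) (z : Euc n) : 0 ≤ w (x + s • z) * paraboloid z := by
    rcases eq_or_ne (paraboloid z) 0 with h | h
    · simp [h]
    · exact mul_nonneg (hpos _ (add_smul_mem_ball hρ hs (norm_lt_one_of_paraboloid_ne_zero h)))
        (paraboloid_nonneg z)
  have hm0 {s : ℝ} (hs : s ∈ Icc 0 ρ) : 0 ≤ weightedMean w x s :=
    integral_nonneg (hmul_nonneg hs)
  have hd {s : ℝ} (hs : s ∈ Icc 0 ρ) :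
      |s * ∫ z : Euc n, lap n w (x + s • z) * quartic z| ≤ L * weightedMean w x s := by
    have h1 : |∫ z : Euc n, lap n w (x + s • z) * quartic z| ≤ L * weightedMean w x s := by
      rw [weightedMean, ← integral_const_mul, ← Real.norm_eq_abs]
      refine norm_integral_le_of_norm_le ((integrable_mul_of_hasCompactSupport
        (F := fun z => w (x + s • z)) (hw.continuous.comp (by fun_prop)) continuous_paraboloid
        hasCompactSupport_paraboloid).const_mul L) (Eventually.of_forall fun z => ?_)
      rw [norm_mul, Real.norm_of_nonneg (quartic_nonneg z), Real.norm_eq_abs]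
      rcases lt_or_ge ‖z‖ 1 with h | h
      · have hmem := add_smul_mem_ball (x := x) hρ hs h
        rw [← mul_assoc]
        exact mul_le_mul (hlap _ hmem) (quartic_le z) (quartic_nonneg z)
          (mul_nonneg hL (hpos _ hmem))
      · simp [quartic_eq_zero h, paraboloid_eq_zero h]
    rw [abs_mul, abs_of_nonneg hs.1]
    have := hs.2
    nlinarith [abs_nonneg (∫ z : Euc n, lap n w (x + s • z) * quartic z), hs.1]
  have hexp (c s : ℝ) : HasDerivAt (fun s => weightedMean w x s * Real.exp (c * s))
      ((s * ∫ z : Euc n, lap n w (x + s • z) * quartic z) * Real.exp (c * s) +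
        weightedMean w x s * (Real.exp (c * s) * c)) s := by
    refine (hasDerivAt_weightedMean hw x s).mul ?_
    have : HasDerivAt (fun s : ℝ => c * s) c s := by simpa using (hasDerivAt_id s).const_mul c
    exact this.exp
  have hcont (c : ℝ) : ContinuousOn (fun s => weightedMean w x s * Real.exp (c * s)) (Icc 0 ρ) :=
    fun s _ => (hexp c s).continuousAt.continuousWithinAt
  have hmono : MonotoneOn (fun s => weightedMean w x s * Real.exp (L * s)) (Icc 0 ρ) := by
    refine monotoneOn_of_deriv_nonneg (convex_Icc _ _) (hcont L)
      (fun s _ => (hexp L s).differentiableAt.differentiableWithinAt) fun s hs => ?_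
    have hs' := interior_subset hs
    rw [(hexp L s).deriv]
    have := neg_le_of_abs_le (hd hs')
    nlinarith [Real.exp_pos (L * s)]
  have hanti : AntitoneOn (fun s => weightedMean w x s * Real.exp (-L * s)) (Icc 0 ρ) := by
    refine antitoneOn_of_deriv_nonpos (convex_Icc _ _) (hcont (-L))
      (fun s _ => (hexp (-L) s).differentiableAt.differentiableWithinAt) fun s hs => ?_
    have hs' := interior_subset hs
    rw [(hexp (-L) s).deriv]
    have := le_of_abs_le (hd hs')
    nlinarith [Real.exp_pos (-L * s)]
  have e0 : (0 : ℝ) ∈ Icc 0 ρ := left_mem_Icc.2 hρ.le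
  have eρ : ρ ∈ Icc 0 ρ := right_mem_Icc.2 hρ.le
  have hLρ : Real.exp (L * ρ) ≤ Real.exp L := Real.exp_le_exp.2 (mul_le_of_le_one_right hL hρ1)
  have h1 := hanti e0 eρ hρ.le
  have h2 := hmono e0 eρ hρ.le
  simp only [mul_zero, Real.exp_zero, mul_one] at h1 h2
  have h3 : Real.exp (-L * ρ) * Real.exp (L * ρ) = 1 := by rw [← Real.exp_add]; simp
  constructor
  · calc weightedMean w x ρ = weightedMean w x ρ * Real.exp (-L * ρ) * Real.exp (L * ρ) := by
          rw [mul_assoc, h3, mul_one]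
      _ ≤ weightedMean w x 0 * Real.exp L :=
          mul_le_mul h1 hLρ (Real.exp_pos _).le (hm0 e0)
      _ = _ := mul_comm _ _
  · calc weightedMean w x 0 ≤ weightedMean w x ρ * Real.exp (L * ρ) := h2
      _ ≤ weightedMean w x ρ * Real.exp L := mul_le_mul_of_nonneg_left hLρ (hm0 eρ)
      _ = _ := mul_comm _ _

lemma weightedMean_le_of_near {w : Euc n → ℝ} (hw : Continuous w) {x x' : Euc n} {r : ℝ}
    (hr : 0 < r) (hxx : ‖x - x'‖ ≤ r / 2) (hpos : ∀ ξ ∈ ball x' (2 * r), 0 ≤ w ξ) :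
    weightedMean w x r ≤ 2 ^ n * (16 / 7) * weightedMean w x' (2 * r) := by
  set a : Euc n := r⁻¹ • (x - x') with ha
  have hra : r • a = x - x' := by rw [ha, smul_inv_smul₀ hr.ne']
  have hna : ‖a‖ ≤ 1 / 2 := by
    rw [ha, norm_smul, norm_inv, Real.norm_of_nonneg hr.le, inv_mul_le_iff₀ hr]; linarith
  have h1 : weightedMean w x r =
      2 ^ n * ∫ z : Euc n, w (x' + (2 * r) • z) * paraboloid ((2 : ℝ) • z - a) := by
    have e1 : weightedMean w x r = ∫ y : Euc n, w (x' + r • y) * paraboloid (y - a) := by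
      rw [weightedMean, ← integral_add_right_eq_self
        (fun y : Euc n => w (x' + r • y) * paraboloid (y - a)) a]
      refine integral_congr_ae (Eventually.of_forall fun z => ?_)
      simp only [smul_add, hra, add_sub_cancel_right]
      congr 2
      abel
    have e2 := Measure.integral_comp_smul (volume : Measure (Euc n))
      (fun y : Euc n => w (x' + r • y) * paraboloid (y - a)) 2
    have e3 : ∫ z : Euc n, w (x' + (2 * r) • z) * paraboloid ((2 : ℝ) • z - a) =
        (2 ^ n)⁻¹ * ∫ y : Euc n, w (x' + r • y) * paraboloid (y - a) := by
      simp only [finrank_euclideanSpace, Fintype.card_fin, smul_eq_mul] at e2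
      rw [abs_of_nonneg (by positivity)] at e2
      rw [← e2]
      refine integral_congr_ae (Eventually.of_forall fun z => ?_)
      simp only [smul_smul, mul_comm]
    rw [e3, e1, mul_inv_cancel_left₀ (by positivity)]
  have hc : Continuous fun z : Euc n => w (x' + (2 * r) • z) := hw.comp (by fun_prop)
  have hzero {z : Euc n} (hz : paraboloid ((2 : ℝ) • z - a) ≠ 0) : ‖z‖ < 3 / 4 := by
    have h := norm_lt_one_of_paraboloid_ne_zero hz
    have h2 : ‖(2 : ℝ) • z‖ ≤ ‖(2 : ℝ) • z - a‖ + ‖a‖ := by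
      simpa using norm_add_le ((2 : ℝ) • z - a) a
    rw [norm_smul, Real.norm_of_nonneg (by norm_num)] at h2
    linarith
  rw [h1, mul_assoc]
  refine mul_le_mul_of_nonneg_left ?_ (by positivity)
  rw [weightedMean, ← integral_const_mul]
  refine integral_mono ?_ ((integrable_mul_of_hasCompactSupport hc continuous_paraboloid
    hasCompactSupport_paraboloid).const_mul _) fun z => ?_
  · refine integrable_mul_of_hasCompactSupport hc (continuous_paraboloid.comp (by fun_prop)) ?_
    refine HasCompactSupport.intro (isCompact_closedBall 0 1) fun z hz => ?_
    by_contra h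
    have := hzero h
    simp only [mem_closedBall, dist_zero_right, not_le] at hz
    linarith
  · simp only
    have hmem {z : Euc n} (hz : ‖z‖ < 1) : 0 ≤ w (x' + (2 * r) • z) :=
      hpos _ (add_smul_mem_ball (by positivity) ⟨by positivity, le_rfl⟩ hz)
    by_cases hz : paraboloid ((2 : ℝ) • z - a) = 0
    · rw [hz, mul_zero]
      rcases lt_or_ge ‖z‖ 1 with h | h
      · exact mul_nonneg (by norm_num) (mul_nonneg (hmem h) (paraboloid_nonneg z))
      · simp [paraboloid_eq_zero h]
    · have h34 := hzero hz
      have hw0 := hmem (z := z) (by linarith)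
      have hp : 7 / 16 ≤ paraboloid z := by
        rw [paraboloid_eq (by linarith)]
        nlinarith [norm_nonneg z]
      have := paraboloid_le_one ((2 : ℝ) • z - a)
      nlinarith

/-- Harnack inequality at neighbouring points. -/
lemma harnack_step {w : Euc n → ℝ} (hw : ContDiff ℝ 2 w) {x x' : Euc n} {r L : ℝ}
    (hr : 0 < r) (hr1 : 2 * r ≤ 1) (hL : 0 ≤ L) (hxx : ‖x - x'‖ ≤ r / 2)
    (hpos : ∀ ξ ∈ ball x' (2 * r), 0 ≤ w ξ)
    (hlap : ∀ ξ ∈ ball x' (2 * r), |lap n w ξ| ≤ L * w ξ) :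
    w x ≤ Real.exp L * (2 ^ n * (16 / 7)) * Real.exp L * w x' := by
  have hsub : ball x r ⊆ ball x' (2 * r) := by
    refine ball_subset_ball' ?_
    rw [dist_eq_norm]; linarith
  have h1 := (weightedMean_comparison hw hr (by linarith) hL (fun ξ hξ => hpos ξ (hsub hξ))
    (fun ξ hξ => hlap ξ (hsub hξ))).2
  have h2 := (weightedMean_comparison hw (by positivity) hr1 hL hpos hlap).1
  have h3 := weightedMean_le_of_near hw.continuous hr hxx hpos
  rw [weightedMean_zero] at h1 h2
  have hI := integral_paraboloid_pos (n := n)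
  have h4 : w x * ∫ z : Euc n, paraboloid z ≤
      (Real.exp L * (2 ^ n * (16 / 7)) * Real.exp L * w x') * ∫ z : Euc n, paraboloid z := by
    calc _ ≤ Real.exp L * weightedMean w x r := h1
      _ ≤ Real.exp L * (2 ^ n * (16 / 7) * (Real.exp L * (w x' * ∫ z : Euc n, paraboloid z))) := by
          gcongr
          exact h3.trans (by gcongr)
      _ = _ := by ring
  exact le_of_mul_le_mul_right h4 hI

/-- Harnack inequality on a ball. -/
lemma exists_harnack (n : ℕ) {L : ℝ} (hL : 0 ≤ L) : ∃ C : ℝ, 0 < C ∧ ∀ (w : Euc n → ℝ) (p : Euc n),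
    ContDiff ℝ 2 w → (∀ ξ ∈ ball p 4, 0 ≤ w ξ) → (∀ ξ ∈ ball p 4, |lap n w ξ| ≤ L * w ξ) →
    ∀ x ∈ closedBall p 3, ∀ y ∈ closedBall p 3, w x ≤ C * w y := by
  set c := Real.exp L * (2 ^ n * (16 / 7)) * Real.exp L with hc
  have hc0 : 0 < c := by positivity
  refine ⟨c ^ 48, by positivity, fun w p hw hpos hlap x hx y hy => ?_⟩
  have hmem (t : ℝ) (ht : t ∈ Icc (0 : ℝ) 1) : y + t • (x - y) ∈ closedBall p 3 :=
    (convex_closedBall p 3).add_smul_sub_mem hy hx ht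
  have key : ∀ k : ℕ, k ≤ 48 → w (y + ((k : ℝ) / 48) • (x - y)) ≤ c ^ k * w y := by
    intro k
    induction k with
    | zero => intro _; simp
    | succ k ih =>
      intro hk
      have hk' : (k : ℝ) / 48 ∈ Icc (0 : ℝ) 1 := by
        refine ⟨by positivity, ?_⟩
        rw [div_le_one (by norm_num)]
        exact_mod_cast (by omega : k ≤ 48)
      have hsub : ball (y + ((k : ℝ) / 48) • (x - y)) (2 * (1 / 4)) ⊆ ball p 4 := by
        refine ball_subset_ball' ?_
        have := hmem _ hk'
        rw [mem_closedBall] at this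
        linarith
      have := harnack_step hw (x := y + (((k + 1 : ℕ) : ℝ) / 48) • (x - y))
        (x' := y + ((k : ℝ) / 48) • (x - y)) (r := 1 / 4) (by norm_num) (by norm_num) hL ?_
        (fun ξ hξ => hpos ξ (hsub hξ)) (fun ξ hξ => hlap ξ (hsub hξ))
      · rw [pow_succ', mul_assoc]
        exact this.trans (mul_le_mul_of_nonneg_left (ih (by omega)) hc0.le)
      · rw [add_sub_add_left_eq_sub, ← sub_smul, norm_smul]
        have hd : ‖x - y‖ ≤ 6 := by
          rw [← dist_eq_norm]
          have := dist_triangle_right x y p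
          rw [mem_closedBall] at hx hy
          linarith
        have he : ‖((k + 1 : ℕ) : ℝ) / 48 - (k : ℝ) / 48‖ = 1 / 48 := by
          rw [show ((k + 1 : ℕ) : ℝ) / 48 - (k : ℝ) / 48 = 1 / 48 by push_cast; ring]
          norm_num
        rw [he]
        linarith
  have := key 48 le_rfl
  norm_num at this
  simpa using this

end InteriorEstimates

section OneDimensionalProfile

variable {n : ℕ}

lemma DoubleWell.exists_lipschitz_deriv {W : ℝ → ℝ} (hW : DoubleWell W) :
    ∃ L : ℝ, 0 ≤ L ∧ ∀ s ∈ Ioo (-1 : ℝ) 1, ∀ t ∈ Ioo (-1 : ℝ) 1,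
      |deriv W s - deriv W t| ≤ L * |s - t| := by
  have hud : UniqueDiffOn ℝ (Icc (-1 : ℝ) 1) := uniqueDiffOn_Icc (by norm_num)
  have h1 : ContDiffOn ℝ 1 (derivWithin W (Icc (-1) 1)) (Icc (-1) 1) :=
    hW.1.derivWithin hud (by norm_num)
  obtain ⟨L, hL⟩ := isCompact_Icc.exists_bound_of_continuousOn
    (h1.continuousOn_derivWithin hud le_rfl)
  have hL0 : 0 ≤ L := (norm_nonneg _).trans (hL 0 (by norm_num))
  refine ⟨L, hL0, fun s hs t ht => ?_⟩
  have h2 := (convex_Icc (-1 : ℝ) 1).norm_image_sub_le_of_norm_derivWithin_le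
    (h1.differentiableOn (by norm_num)) hL (Ioo_subset_Icc_self ht) (Ioo_subset_Icc_self hs)
  rwa [derivWithin_of_mem_nhds (Icc_mem_nhds hs.1 hs.2),
    derivWithin_of_mem_nhds (Icc_mem_nhds ht.1 ht.2)] at h2

lemma lap_comp_add (u : Euc n → ℝ) (a x : Euc n) :
    lap n (fun y => u (y + a)) x = lap n u (x + a) := by
  unfold lap
  refine Finset.sum_congr rfl fun i _ => ?_
  simp only [fderiv_comp_add_right]
  rw [fderiv_comp_add_right (f := fun y => fderiv ℝ u y (EuclideanSpace.single i 1)) a]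

lemma differentiable_fderiv_apply {u : Euc n → ℝ} (hu : ContDiff ℝ 2 u) (e : Euc n) :
    Differentiable ℝ fun y => fderiv ℝ u y e :=
  ((hu.fderiv_right (m := 1) (by norm_num)).clm_apply contDiff_const).differentiable (by norm_num)

lemma lap_sub {u v : Euc n → ℝ} (hu : ContDiff ℝ 2 u) (hv : ContDiff ℝ 2 v) (x : Euc n) :
    lap n (fun y => u y - v y) x = lap n u x - lap n v x := by
  unfold lap
  rw [← Finset.sum_sub_distrib]
  refine Finset.sum_congr rfl fun i _ => ?_
  have : (fun y => fderiv ℝ (fun y => u y - v y) y (EuclideanSpace.single i 1)) =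
      fun y => fderiv ℝ u y (EuclideanSpace.single i 1) -
        fderiv ℝ v y (EuclideanSpace.single i 1) := by
    funext y
    rw [fderiv_fun_sub (hu.differentiable (by norm_num) y) (hv.differentiable (by norm_num) y)]
    rfl
  rw [this, fderiv_fun_sub (differentiable_fderiv_apply hu _ x) (differentiable_fderiv_apply hv _ x)]
  rfl

lemma lap_add_const (u : Euc n → ℝ) (c : ℝ) (x : Euc n) :
    lap n (fun y => u y + c) x = lap n u x := by
  simp only [lap, fderiv_add_const]

lemma hasFDerivAt_planar {g : ℝ → ℝ} (hg : Differentiable ℝ g) (ν : Euc n) (R : ℝ) (x : Euc n) :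
    HasFDerivAt (fun x : Euc n => g (⟪x, ν⟫ - R)) (deriv g (⟪x, ν⟫ - R) • innerSL ℝ ν) x := by
  have h1 : HasFDerivAt (fun x : Euc n => ⟪x, ν⟫ - R) (innerSL ℝ ν) x := by
    have := ((innerSL ℝ ν).hasFDerivAt (x := x)).sub_const R
    simpa only [innerSL_apply_apply, real_inner_comm] using this
  exact (hg _).hasDerivAt.comp_hasFDerivAt x h1

lemma lap_planar {g : ℝ → ℝ} (hg : ContDiff ℝ 2 g) {ν : Euc n} (hν : ‖ν‖ = 1) (R : ℝ) (x : Euc n) :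
    lap n (fun x : Euc n => g (⟪x, ν⟫ - R)) x = deriv (deriv g) (⟪x, ν⟫ - R) := by
  have hd : Differentiable ℝ (deriv g) :=
    ((contDiff_succ_iff_deriv (n := 1)).1 (hg.of_le (by norm_num))).2.2.differentiable (by norm_num)
  unfold lap
  have h1 (i : Fin n) : fderiv ℝ (fun y => fderiv ℝ (fun x : Euc n => g (⟪x, ν⟫ - R)) y
      (EuclideanSpace.single i 1)) x (EuclideanSpace.single i 1) =
      deriv (deriv g) (⟪x, ν⟫ - R) * ν i ^ 2 := by
    have e : (fun y => fderiv ℝ (fun x : Euc n => g (⟪x, ν⟫ - R)) y (EuclideanSpace.single i 1)) =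
        fun y => deriv g (⟪y, ν⟫ - R) * ν i := by
      funext y
      rw [(hasFDerivAt_planar (hg.differentiable (by norm_num)) ν R y).fderiv]
      simp [EuclideanSpace.inner_single_right]
    rw [e, ((hasFDerivAt_planar hd ν R x).mul_const (ν i)).fderiv]
    simp [EuclideanSpace.inner_single_right]
    ring
  simp only [h1, ← Finset.mul_sum]
  have h2 := EuclideanSpace.norm_sq_eq ν
  rw [hν] at h2
  simp only [Real.norm_eq_abs, sq_abs] at h2
  rw [← h2]; ring

lemma contDiff_planar {g : ℝ → ℝ} (hg : ContDiff ℝ 2 g) (ν : Euc n) (R : ℝ) :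
    ContDiff ℝ 2 fun x : Euc n => g (⟪x, ν⟫ - R) :=
  hg.comp ((contDiff_id.inner ℝ contDiff_const).sub contDiff_const)

/-- One-sided closeness to the planar profile together with almost contact at one point gives
two-sided closeness. -/
lemma exists_two_sided_bound (n : ℕ) {W g : ℝ → ℝ} (hW : DoubleWell W) (hg : IsOneDSolution W g) :
    ∃ C : ℝ, 0 < C ∧ ∀ (ν p : Euc n) (R ε : ℝ) (u : Euc n → ℝ), ‖ν‖ = 1 → 0 < ε → ContDiff ℝ 2 u →
      (∀ x, u x ∈ Ioo (-1 : ℝ) 1) → (∀ x, lap n u x = deriv W (u x)) →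
      (∀ x ∈ ball p 4, u x ≤ g (⟪x, ν⟫ - R) + ε) →
      (∃ y ∈ closedBall p 3, g (⟪y, ν⟫ - R) ≤ u y + ε) →
      ∀ x ∈ closedBall p 3, |u x - g (⟪x, ν⟫ - R)| ≤ C * ε := by
  obtain ⟨L, hL0, hL⟩ := hW.exists_lipschitz_deriv
  obtain ⟨C, hC0, hC⟩ := exists_harnack n (L := 3 * L) (by positivity)
  refine ⟨3 * C + 2, by positivity, ?_⟩
  rintro ν p R ε u hν hε hu humem hulap hle ⟨y, hy, hyc⟩ x hx
  obtain ⟨hg2, hgmem, hgeq, -⟩ := hg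
  set w : Euc n → ℝ := fun x => g (⟪x, ν⟫ - R) - u x + 2 * ε with hw
  have hG := contDiff_planar hg2 ν R
  have hwC : ContDiff ℝ 2 w := (hG.sub hu).add contDiff_const
  have hwε : ∀ ξ ∈ ball p 4, ε ≤ w ξ := fun ξ hξ => by
    have := hle ξ hξ
    simp only [hw]; linarith
  have hwlap : ∀ ξ ∈ ball p 4, |lap n w ξ| ≤ 3 * L * w ξ := fun ξ hξ => by
    have h1 : lap n w ξ = deriv W (g (⟪ξ, ν⟫ - R)) - deriv W (u ξ) := by
      rw [hw, lap_add_const (fun x => g (⟪x, ν⟫ - R) - u x), lap_sub hG hu, lap_planar hg2 hν,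
        hulap, hgeq]
    rw [h1]
    refine (hL _ (hgmem _) _ (humem ξ)).trans ?_
    have h2 : |g (⟪ξ, ν⟫ - R) - u ξ| ≤ 3 * w ξ := by
      have := hwε ξ hξ
      rw [abs_le]
      simp only [hw] at this ⊢
      constructor <;> linarith
    calc _ ≤ L * (3 * w ξ) := mul_le_mul_of_nonneg_left h2 hL0
      _ = _ := by ring
  have hfin := hC w p hwC (fun ξ hξ => hε.le.trans (hwε ξ hξ)) hwlap x hx y hy
  have hwy : w y ≤ 3 * ε := by simp only [hw]; linarith
  have hwx := hwε x (closedBall_subset_ball (by norm_num) hx)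
  have h3 : C * w y ≤ C * (3 * ε) := mul_le_mul_of_nonneg_left hwy hC0.le
  simp only [hw] at hfin hwx h3
  rw [abs_le]
  constructor <;> nlinarith

/-- Difference quotients control the Lipschitz constant of a directional derivative. -/
lemma abs_fderiv_sub_le {W : ℝ → ℝ} {L : ℝ} (hL0 : 0 ≤ L)
    (hL : ∀ s ∈ Ioo (-1 : ℝ) 1, ∀ t ∈ Ioo (-1 : ℝ) 1, |deriv W s - deriv W t| ≤ L * |s - t|)
    {u : Euc n → ℝ} (hu : ContDiff ℝ 2 u) (humem : ∀ x, u x ∈ Ioo (-1 : ℝ) 1)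
    (hulap : ∀ x, lap n u x = deriv W (u x)) {p e : Euc n} {ρ r A δ : ℝ} (hr : 0 < r) (hδ : 0 < δ)
    (hA : ∀ x ∈ ball p (ρ + r), ∀ t : ℝ, |t| < δ → |u (x + t • e) - u x| ≤ A * |t|)
    {x x' : Euc n} (hx : x ∈ ball p ρ) (hx' : x' ∈ ball p ρ) :
    |fderiv ℝ u x' e - fderiv ℝ u x e| ≤ lipConst n * (1 / r + L * r) * A * ‖x' - x‖ := by
  have hquot (x : Euc n) : Tendsto (fun t : ℝ => t⁻¹ * (u (x + t • e) - u x)) (nhdsWithin 0 (Ioi 0))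
      (nhds (fderiv ℝ u x e)) := by
    have h1 : HasDerivAt (u ∘ fun t : ℝ => x + t • e) (fderiv ℝ u x e) 0 := by
      have h2 : HasDerivAt (fun t : ℝ => x + t • e) e 0 := by
        simpa using ((hasDerivAt_id (0 : ℝ)).smul_const e).const_add x
      have h3 := (hu.differentiable (by norm_num) (x + (0 : ℝ) • e)).hasFDerivAt
      simpa using h3.comp_hasDerivAt (0 : ℝ) h2
    have := h1.tendsto_slope_zero_right
    simpa using this
  refine le_of_tendsto (((hquot x').sub (hquot x)).abs) ?_
  filter_upwards [Ioo_mem_nhdsGT hδ] with t ht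
  have htabs : |t| < δ := by rw [abs_of_pos ht.1]; exact ht.2
  have hT : ContDiff ℝ 2 fun y => u (y + t • e) := hu.comp (contDiff_id.add contDiff_const)
  have hC : ContDiff ℝ 2 fun y => u (y + t • e) - u y := hT.sub hu
  have := abs_sub_le_of_abs_lap_le hC (p := p) (ρ := ρ) (r := r) (A := A * |t|)
    (B := L * (A * |t|)) hr (fun y hy => hA y hy t htabs) (fun y hy => ?_) hx hx'
  · rw [← mul_sub, abs_mul, abs_inv, abs_of_pos ht.1, inv_mul_le_iff₀ ht.1]
    rw [abs_of_pos ht.1] at this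
    refine this.trans_eq ?_
    ring
  · rw [lap_sub hT hu, lap_comp_add, hulap, hulap]
    exact (hL _ (humem _) _ (humem _)).trans (mul_le_mul_of_nonneg_left (hA y hy t htabs) hL0)

/-- First and second order interior estimates for solutions close to a planar profile. -/
lemma exists_derivative_estimates (n : ℕ) {W g : ℝ → ℝ} (hW : DoubleWell W)
    (hg : IsOneDSolution W g) :
    ∃ C : ℝ, 0 < C ∧ ∀ (ν p : Euc n) (R ε : ℝ) (u : Euc n → ℝ), ‖ν‖ = 1 → 0 ≤ ε → ContDiff ℝ 2 u →
      (∀ x, u x ∈ Ioo (-1 : ℝ) 1) → (∀ x, lap n u x = deriv W (u x)) →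
      (∀ x ∈ ball p 3, |u x - g (⟪x, ν⟫ - R)| ≤ ε) →
      (∀ x ∈ ball p 2, ∀ e, |fderiv ℝ u x e - deriv g (⟪x, ν⟫ - R) * ⟪e, ν⟫| ≤ C * ε * ‖e‖) ∧
      (∀ x ∈ ball p 2, ∀ x' ∈ ball p 2, ∀ e, ⟪e, ν⟫ = 0 →
        |fderiv ℝ u x' e - fderiv ℝ u x e| ≤ C * ε * ‖x' - x‖ * ‖e‖) ∧
      (∀ x ∈ ball p 2, ∀ x' ∈ ball p 2, ∀ e,
        |fderiv ℝ u x' e - fderiv ℝ u x e| ≤ C * ‖x' - x‖ * ‖e‖) := by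
  obtain ⟨L, hL0, hL⟩ := hW.exists_lipschitz_deriv
  set M := |deriv W 0| + L with hM
  have hbound : ∀ s ∈ Ioo (-1 : ℝ) 1, |deriv W s| ≤ M := fun s hs => by
    have h1 := hL s hs 0 (by norm_num)
    have h2 := abs_sub_abs_le_abs_sub (deriv W s) (deriv W 0)
    have h3 : |s - 0| ≤ 1 := by rw [sub_zero, abs_le]; exact ⟨hs.1.le, hs.2.le⟩
    nlinarith
  have hM0 : 0 ≤ M := by positivity
  have hl := lipConst_nonneg n
  set a := lipConst n * (1 / (1 / 2) + L * (1 / 2)) with ha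
  set b := lipConst n * (1 / (1 / 2) + M * (1 / 2)) with hb
  set c := lipConst n * (1 / (1 / 4) + L * (1 / 4)) with hc
  have ha0 : 0 ≤ a := by positivity
  have hb0 : 0 ≤ b := by positivity
  have hc0 : 0 ≤ c := by positivity
  refine ⟨a + c * a + c * b + 1, by positivity, ?_⟩
  intro ν p R ε u hν hε hu humem hulap hclose
  obtain ⟨hg2, hgmem, hgeq, -⟩ := hg
  have hG := contDiff_planar hg2 ν R
  set v : Euc n → ℝ := fun x => u x - g (⟪x, ν⟫ - R) with hv
  have hvC : ContDiff ℝ 2 v := hu.sub hG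
  have hvlip : ∀ x ∈ ball p (5 / 2), ∀ x' ∈ ball p (5 / 2), |v x' - v x| ≤ a * ε * ‖x' - x‖ := by
    intro x hx x' hx'
    have := abs_sub_le_of_abs_lap_le hvC (p := p) (ρ := 5 / 2) (r := 1 / 2) (A := ε) (B := L * ε)
      (by norm_num) (fun y hy => hclose y (by norm_num at hy ⊢; exact hy)) (fun y hy => ?_) hx hx'
    · refine this.trans_eq ?_
      rw [ha]; ring
    · rw [hv, lap_sub hu hG, hulap, lap_planar hg2 hν, hgeq]
      exact (hL _ (humem _) _ (hgmem _)).trans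
        (mul_le_mul_of_nonneg_left (hclose y (by norm_num at hy ⊢; exact hy)) hL0)
  have hulip : ∀ x ∈ ball p (5 / 2), ∀ x' ∈ ball p (5 / 2), |u x' - u x| ≤ b * ‖x' - x‖ := by
    intro x hx x' hx'
    have := abs_sub_le_of_abs_lap_le hu (p := p) (ρ := 5 / 2) (r := 1 / 2) (A := 1) (B := M)
      (by norm_num) (fun y _ => abs_le.2 ⟨(humem y).1.le, (humem y).2.le⟩)
      (fun y _ => by rw [hulap]; exact hbound _ (humem y)) hx hx'
    exact this
  have hmem {x : Euc n} (hx : x ∈ ball p (2 + 1 / 4)) {e : Euc n} (he : ‖e‖ ≤ 1) {t : ℝ}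
      (ht : |t| < 1 / 4) : x ∈ ball p (5 / 2) ∧ x + t • e ∈ ball p (5 / 2) := by
    refine ⟨ball_subset_ball (by norm_num) hx, ?_⟩
    rw [mem_ball] at hx ⊢
    have h1 : dist (x + t • e) x ≤ |t| := by
      rw [dist_eq_norm, add_sub_cancel_left, norm_smul, Real.norm_eq_abs]
      exact mul_le_of_le_one_right (abs_nonneg _) he
    linarith [dist_triangle (x + t • e) x p]
  have htan {e : Euc n} (he : ‖e‖ ≤ 1) (heν : ⟪e, ν⟫ = 0) {x x' : Euc n} (hx : x ∈ ball p 2)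
      (hx' : x' ∈ ball p 2) :
      |fderiv ℝ u x' e - fderiv ℝ u x e| ≤ c * (a * ε) * ‖x' - x‖ := by
    refine abs_fderiv_sub_le hL0 hL hu humem hulap (r := 1 / 4) (δ := 1 / 4) (by norm_num)
      (by norm_num) (fun y hy t ht => ?_) hx hx'
    obtain ⟨h1, h2⟩ := hmem hy he ht
    have h3 := hvlip y h1 _ h2
    simp only [hv, inner_add_left, inner_smul_left, heν, mul_zero, add_zero, sub_sub_sub_cancel_right,
      add_sub_cancel_left, norm_smul, Real.norm_eq_abs] at h3
    refine h3.trans (mul_le_mul_of_nonneg_left ?_ (by positivity))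
    exact mul_le_of_le_one_right (abs_nonneg _) he
  have hfull {e : Euc n} (he : ‖e‖ ≤ 1) {x x' : Euc n} (hx : x ∈ ball p 2) (hx' : x' ∈ ball p 2) :
      |fderiv ℝ u x' e - fderiv ℝ u x e| ≤ c * b * ‖x' - x‖ := by
    refine abs_fderiv_sub_le hL0 hL hu humem hulap (r := 1 / 4) (δ := 1 / 4) (by norm_num)
      (by norm_num) (fun y hy t ht => ?_) hx hx'
    obtain ⟨h1, h2⟩ := hmem hy he ht
    have h3 := hulip y h1 _ h2
    simp only [add_sub_cancel_left, norm_smul, Real.norm_eq_abs] at h3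
    refine h3.trans (mul_le_mul_of_nonneg_left ?_ hb0)
    exact mul_le_of_le_one_right (abs_nonneg _) he
  have hscale {Λ : Euc n →L[ℝ] ℝ} {B : ℝ} {S : Submodule ℝ (Euc n)}
      (h : ∀ e ∈ S, ‖e‖ ≤ 1 → |Λ e| ≤ B) {e : Euc n} (he : e ∈ S) : |Λ e| ≤ B * ‖e‖ := by
    rcases eq_or_ne e 0 with rfl | h0
    · simp
    · have hn : 0 < ‖e‖ := norm_pos_iff.2 h0
      have := h (‖e‖⁻¹ • e) (S.smul_mem _ he) (by rw [norm_smul]; simp [h0])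
      rwa [map_smul, smul_eq_mul, abs_mul, abs_inv, abs_norm, inv_mul_le_iff₀ hn, mul_comm] at this
  refine ⟨fun x hx e => ?_, fun x hx x' hx' e he => ?_, fun x hx x' hx' e => ?_⟩
  · have hvd : ‖fderiv ℝ v x‖ ≤ a * ε := by
      refine norm_fderiv_le_of_lip' ℝ (by positivity) ?_
      have hxb : x ∈ ball p (5 / 2) := ball_subset_ball (by norm_num) hx
      filter_upwards [isOpen_ball.mem_nhds hxb] with y hy
      exact hvlip x hxb y hy
    have h1 : fderiv ℝ u x e - deriv g (⟪x, ν⟫ - R) * ⟪e, ν⟫ = fderiv ℝ v x e := by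
      rw [hv, fderiv_fun_sub (hu.differentiable (by norm_num) x) (hG.differentiable (by norm_num) x),
        (hasFDerivAt_planar (hg2.differentiable (by norm_num)) ν R x).fderiv]
      simp [real_inner_comm]
    rw [h1]
    refine ((fderiv ℝ v x).le_opNorm e).trans (mul_le_mul_of_nonneg_right (hvd.trans ?_)
      (norm_nonneg _))
    exact mul_le_mul_of_nonneg_right (by nlinarith [mul_nonneg hc0 ha0, mul_nonneg hc0 hb0]) hε
  · have := hscale (Λ := fderiv ℝ u x' - fderiv ℝ u x) (B := c * (a * ε) * ‖x' - x‖)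
      (S := LinearMap.ker (innerSL ℝ ν).toLinearMap) (fun e he1 he2 => ?_) (e := e) ?_
    · refine this.trans (mul_le_mul_of_nonneg_right ?_ (norm_nonneg _))
      rw [← mul_assoc]
      refine mul_le_mul_of_nonneg_right (mul_le_mul_of_nonneg_right ?_ hε) (norm_nonneg _)
      nlinarith [mul_nonneg hc0 hb0]
    · refine htan he2 ?_ hx hx'
      rw [real_inner_comm]
      simpa using he1
    · rw [real_inner_comm] at he
      simpa using he
  · have := hscale (Λ := fderiv ℝ u x' - fderiv ℝ u x) (B := c * b * ‖x' - x‖)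
      (S := ⊤) (fun e _ he2 => hfull he2 hx hx') (e := e) trivial
    refine this.trans (mul_le_mul_of_nonneg_right ?_ (norm_nonneg _))
    refine mul_le_mul_of_nonneg_right ?_ (norm_nonneg _)
    nlinarith [mul_nonneg hc0 ha0]

end OneDimensionalProfile

section Graph

variable {n : ℕ}

/-- Orthogonal projection along the unit vector `ν`. -/
def tangentialPart (ν : Euc n) : Euc n →L[ℝ] Euc n :=
  ContinuousLinearMap.id ℝ (Euc n) - (innerSL ℝ ν).smulRight ν

lemma tangentialPart_apply (ν x : Euc n) : tangentialPart ν x = x - ⟪x, ν⟫ • ν := by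
  simp [tangentialPart, real_inner_comm]

lemma inner_tangentialPart {ν : Euc n} (hν : ‖ν‖ = 1) (x : Euc n) : ⟪tangentialPart ν x, ν⟫ = 0 := by
  rw [tangentialPart_apply, inner_sub_left, inner_smul_left, real_inner_self_eq_norm_sq, hν]
  simp

lemma norm_sq_add_smul {ν z : Euc n} (hν : ‖ν‖ = 1) (hz : ⟪z, ν⟫ = 0) (s : ℝ) :
    ‖z + s • ν‖ ^ 2 = ‖z‖ ^ 2 + s ^ 2 := by
  rw [norm_add_sq_real, inner_smul_right, hz, norm_smul, hν]
  simp

lemma norm_sq_eq_tangentialPart {ν : Euc n} (hν : ‖ν‖ = 1) (x : Euc n) :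
    ‖x‖ ^ 2 = ‖tangentialPart ν x‖ ^ 2 + ⟪x, ν⟫ ^ 2 := by
  rw [← norm_sq_add_smul hν (inner_tangentialPart hν x), tangentialPart_apply, sub_add_cancel]

lemma norm_tangentialPart_le {ν : Euc n} (hν : ‖ν‖ = 1) (x : Euc n) :
    ‖tangentialPart ν x‖ ≤ ‖x‖ := by
  have := norm_sq_eq_tangentialPart hν x
  exact le_of_sq_le_sq (by nlinarith [sq_nonneg ⟪x, ν⟫]) (norm_nonneg _)

lemma tangentialPart_of_inner_eq_zero {ν z : Euc n} (hz : ⟪z, ν⟫ = 0) : tangentialPart ν z = z := by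
  rw [tangentialPart_apply, hz, zero_smul, sub_zero]

/-- A smooth truncation of the identity. -/
lemma exists_truncation (n : ℕ) : ∃ (θ : Euc n → Euc n) (T : ℝ), 1 ≤ T ∧ ContDiff ℝ 2 θ ∧
    (∀ z, ‖z‖ ≤ 1 → θ z = z) ∧ (∀ z, ‖θ z‖ ≤ 3 / 2) ∧ (∀ z, ‖fderiv ℝ θ z‖ ≤ T) ∧
    (∀ z z', ‖θ z - θ z'‖ ≤ T * ‖z - z'‖) ∧
    ∀ z z', ‖fderiv ℝ θ z - fderiv ℝ θ z'‖ ≤ T * ‖z - z'‖ := by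
  let χ : ContDiffBump (0 : Euc n) := ⟨1, 3 / 2, by norm_num, by norm_num⟩
  let θ : Euc n → Euc n := fun z => χ z • z
  have hθ : ContDiff ℝ 2 θ := χ.contDiff.smul contDiff_id
  have hs : HasCompactSupport θ := χ.hasCompactSupport.smul_right
  have hD : ContDiff ℝ 1 (fderiv ℝ θ) := hθ.fderiv_right (by norm_num)
  obtain ⟨A, hA⟩ := (hs.fderiv ℝ).exists_bound_of_continuous hD.continuous
  obtain ⟨B, hB⟩ := ContDiff.lipschitzWith_of_hasCompactSupport hs hθ (by norm_num)
  obtain ⟨C, hC⟩ := ContDiff.lipschitzWith_of_hasCompactSupport (hs.fderiv ℝ) hD (by norm_num)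
  have hA0 : 0 ≤ A := (norm_nonneg _).trans (hA 0)
  refine ⟨θ, 1 + A + B + C, by linarith [B.2, C.2, B.coe_nonneg, C.coe_nonneg], hθ,
    fun z hz => ?_, fun z => ?_, fun z => (hA z).trans ?_, fun z z' => ?_, fun z z' => ?_⟩
  · have : χ z = 1 := χ.one_of_mem_closedBall (by simpa using hz)
    simp [θ, this]
  · rcases le_or_gt (3 / 2) ‖z‖ with h | h
    · have : χ z = 0 := χ.zero_of_le_dist (by simpa using h)
      simp only [θ, this, zero_smul, norm_zero]; norm_num
    · rw [norm_smul, Real.norm_of_nonneg χ.nonneg]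
      exact (mul_le_of_le_one_left (norm_nonneg _) χ.le_one).trans h.le
  · linarith [B.coe_nonneg, C.coe_nonneg]
  · rw [← dist_eq_norm, ← dist_eq_norm]
    exact (hB.dist_le_mul z z').trans (mul_le_mul_of_nonneg_right
      (by linarith [C.coe_nonneg]) dist_nonneg)
  · rw [← dist_eq_norm, ← dist_eq_norm]
    exact (hC.dist_le_mul z z').trans (mul_le_mul_of_nonneg_right
      (by linarith [B.coe_nonneg]) dist_nonneg)

/-- Global implicit function: a `C²` function of `(z, s)` increasing in `s` across its zero. -/
lemma exists_contDiff_zero {E : Type*} [NormedAddCommGroup E] [NormedSpace ℝ E] [CompleteSpace E]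
    {F : E × ℝ → ℝ} (hF : ContDiff ℝ 2 F) {a b : ℝ} (hab : a < b)
    (ha : ∀ z, F (z, a) < 0) (hb : ∀ z, 0 < F (z, b))
    (hpos : ∀ z, ∀ s ∈ Icc a b, 0 < fderiv ℝ F (z, s) (0, 1)) :
    ∃ h : E → ℝ, ContDiff ℝ 2 h ∧ (∀ z, h z ∈ Ioo a b) ∧
      ∀ z, ∀ s ∈ Icc a b, F (z, s) = 0 ↔ s = h z := by
  have hsec (z : E) (s : ℝ) : HasDerivAt (fun s => F (z, s)) (fderiv ℝ F (z, s) (0, 1)) s :=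
    (hF.differentiable (by norm_num) (z, s)).hasFDerivAt.comp_hasDerivAt s
      ((hasDerivAt_const s z).prodMk (hasDerivAt_id s))
  have hmono (z : E) : StrictMonoOn (fun s => F (z, s)) (Icc a b) := by
    refine strictMonoOn_of_deriv_pos (convex_Icc a b)
      (fun s _ => (hsec z s).continuousAt.continuousWithinAt) fun s hs => ?_
    rw [(hsec z s).deriv]
    exact hpos z s (interior_subset hs)
  have hex (z : E) : ∃ s ∈ Ioo a b, F (z, s) = 0 := by
    obtain ⟨s, hs, h0⟩ := intermediate_value_Ioo hab.le
      (f := fun s => F (z, s)) (fun s _ => (hsec z s).continuousAt.continuousWithinAt)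
      (show (0 : ℝ) ∈ Ioo (F (z, a)) (F (z, b)) from ⟨ha z, hb z⟩)
    exact ⟨s, hs, h0⟩
  choose h hmem hzero using hex
  have huniq : ∀ z, ∀ s ∈ Icc a b, F (z, s) = 0 ↔ s = h z := fun z s hs =>
    ⟨fun h0 => (hmono z).injOn hs (Ioo_subset_Icc_self (hmem z)) (h0.trans (hzero z).symm),
      fun h0 => h0 ▸ hzero z⟩
  refine ⟨h, contDiff_iff_contDiffAt.2 fun z => ?_, hmem, huniq⟩
  have hFz : ContDiffAt ℝ 2 F (z, h z) := hF.contDiffAt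
  have hinv : (fderiv ℝ F (z, h z) ∘L .inr ℝ E ℝ).IsInvertible := by
    have hne := (hpos z (h z) (Ioo_subset_Icc_self (hmem z))).ne'
    refine ⟨ContinuousLinearEquiv.unitsEquivAut ℝ (Units.mk0 _ hne), ?_⟩
    ext
    simp
  refine (hFz.contDiffAt_implicitFunction (by norm_num) hinv).congr_of_eventuallyEq ?_
  have hcont : ContinuousAt (hFz.implicitFunction (by norm_num) hinv) z :=
    (hFz.contDiffAt_implicitFunction (by norm_num) hinv).continuousAt
  have hself : hFz.implicitFunction (by norm_num) hinv z = h z :=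
    hFz.implicitFunction_apply_self (by norm_num) hinv
  filter_upwards [hFz.eventually_apply_implicitFunction (by norm_num) hinv,
    hcont.eventually_mem (Ioo_mem_nhds (hself ▸ (hmem z).1) (hself ▸ (hmem z).2))] with y hy hy'
  exact ((huniq y _ (Ioo_subset_Icc_self hy')).1 (hy.trans (hzero z))).symm

/-- The quotient estimate behind the Hessian bound for implicitly defined graphs. -/
lemma abs_neg_div_sub_neg_div_le {a a' d d' c α β δ : ℝ} (hc : 0 < c) (hd : c ≤ d) (hd' : c ≤ d')
    (ha : |a - a'| ≤ α) (ha' : |a'| ≤ β) (hdd : |d - d'| ≤ δ) :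
    |-a / d - -a' / d'| ≤ α / c + β * δ / c ^ 2 := by
  have hd0 : 0 < d := hc.trans_le hd
  have hd0' : 0 < d' := hc.trans_le hd'
  have hα : 0 ≤ α := (abs_nonneg _).trans ha
  have hβ : 0 ≤ β := (abs_nonneg _).trans ha'
  have hδ : 0 ≤ δ := (abs_nonneg _).trans hdd
  have e : -a / d - -a' / d' = -((a - a') / d) + a' * (d - d') / (d * d') := by
    field_simp
    ring
  rw [e]
  refine (abs_add_le _ _).trans (add_le_add ?_ ?_)
  · rw [abs_neg, abs_div, abs_of_pos hd0]
    gcongr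
  · rw [abs_div, abs_mul, abs_of_pos (mul_pos hd0 hd0'), sq]
    gcongr

/-- The zero level of a function close to a planar increasing profile is a flat graph. -/
lemma exists_graph (n : ℕ) {c C : ℝ} (hc : 0 < c) (hC : 0 ≤ C) :
    ∃ C' : ℝ, 0 < C' ∧ ∀ (ν : Euc n) (R ε : ℝ) (u : Euc n → ℝ), ‖ν‖ = 1 → 0 ≤ ε → ε ≤ 1 →
      ContDiff ℝ 2 u →
      (∀ x ∈ ball (R • ν) 2, c ≤ fderiv ℝ u x ν) →
      (∀ x ∈ ball (R • ν) 2, ∀ e, ⟪e, ν⟫ = 0 → |fderiv ℝ u x e| ≤ C * ε * ‖e‖) →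
      (∀ x ∈ ball (R • ν) 2, ∀ x' ∈ ball (R • ν) 2, ∀ e, ⟪e, ν⟫ = 0 →
        |fderiv ℝ u x' e - fderiv ℝ u x e| ≤ C * ε * ‖x' - x‖ * ‖e‖) →
      (∀ x ∈ ball (R • ν) 2, ∀ x' ∈ ball (R • ν) 2, ∀ e,
        |fderiv ℝ u x' e - fderiv ℝ u x e| ≤ C * ‖x' - x‖ * ‖e‖) →
      (∀ x ∈ ball (R • ν) 2, ⟪x, ν⟫ = R - 1 → u x < 0) →
      (∀ x ∈ ball (R • ν) 2, ⟪x, ν⟫ = R + 1 → 0 < u x) →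
      ∃ h : Euc n → ℝ, ContDiff ℝ 2 h ∧ (∀ z, ‖iteratedFDeriv ℝ 2 h z‖ ≤ C' * ε) ∧
        ∀ x ∈ ball (R • ν) 1, (u x = 0 ↔ ⟪x, ν⟫ = h (x - ⟪x, ν⟫ • ν)) := by
  obtain ⟨θ, T, hT1, hθ, hθid, hθle, hDθ, hθlip, hDθlip⟩ := exists_truncation n
  have hT0 : 0 ≤ T := by linarith
  set Λ := T + C * T / c with hΛ
  have hΛ0 : 0 ≤ Λ := by positivity
  refine ⟨(C * Λ * T + C * T) / c + C * T * (C * Λ) / c ^ 2 + 1, by positivity, ?_⟩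
  intro ν R ε u hν hε hε1 hu hlow htan htanlip hlip hneg hposu
  set P := tangentialPart ν with hP
  have hPν (x : Euc n) : ⟪P x, ν⟫ = 0 := inner_tangentialPart hν x
  have hPle (x : Euc n) : ‖P x‖ ≤ ‖x‖ := norm_tangentialPart_le hν x
  have hinner (z : Euc n) (s : ℝ) : ⟪P (θ z) + s • ν, ν⟫ = s := by
    rw [inner_add_left, hPν, inner_smul_left, real_inner_self_eq_norm_sq, hν]; simp
  have hball (z : Euc n) {s : ℝ} (hs : s ∈ Icc (R - 1) (R + 1)) :
      P (θ z) + s • ν ∈ ball (R • ν) 2 := by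
    rw [mem_ball, dist_eq_norm, add_sub_assoc, ← sub_smul]
    refine lt_of_pow_lt_pow_left₀ 2 (by norm_num) ?_
    rw [norm_sq_add_smul hν (hPν _)]
    have h1 := (hPle (θ z)).trans (hθle z)
    nlinarith [hs.1, hs.2, norm_nonneg (P (θ z))]
  set X : Euc n × ℝ → Euc n := fun q => P (θ q.1) + q.2 • ν with hX
  have hXC : ContDiff ℝ 2 X :=
    (P.contDiff.comp (hθ.comp contDiff_fst)).add (contDiff_snd.smul contDiff_const)
  have hXd (z : Euc n) (s : ℝ) : fderiv ℝ (u ∘ X) (z, s) (0, 1) = fderiv ℝ u (P (θ z) + s • ν) ν := by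
    have h1 : HasDerivAt (fun s : ℝ => X (z, s)) ν s := by
      simpa [hX] using ((hasDerivAt_id s).smul_const ν).const_add (P (θ z))
    have h2 := (hu.differentiable (by norm_num) (X (z, s))).hasFDerivAt.comp_hasDerivAt s h1
    have h3 := ((hu.comp hXC).differentiable (by norm_num) (z, s)).hasFDerivAt.comp_hasDerivAt s
      ((hasDerivAt_const s z).prodMk (hasDerivAt_id s))
    exact h3.unique h2
  obtain ⟨h, hhC, hhmem, hhiff⟩ := exists_contDiff_zero (hu.comp hXC) (a := R - 1) (b := R + 1)
    (by linarith)
    (fun z => hneg _ (hball z ⟨le_rfl, by linarith⟩) (hinner z _))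
    (fun z => hposu _ (hball z ⟨by linarith, le_rfl⟩) (hinner z _))
    (fun z s hs => by rw [hXd]; exact hc.trans_le (hlow _ (hball z hs)))
  set A : Euc n → Euc n := fun z => P (θ z) + h z • ν with hA
  have hAmem (z : Euc n) : A z ∈ ball (R • ν) 2 := hball z (Ioo_subset_Icc_self (hhmem z))
  have hA0 (z : Euc n) : u (A z) = 0 := (hhiff z _ (Ioo_subset_Icc_self (hhmem z))).2 rfl
  have hhd : Differentiable ℝ h := hhC.differentiable (by norm_num)
  have hform (z e : Euc n) :
      fderiv ℝ h z e = -fderiv ℝ u (A z) (P (fderiv ℝ θ z e)) / fderiv ℝ u (A z) ν := by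
    have h1 : HasFDerivAt A (P ∘L fderiv ℝ θ z + (fderiv ℝ h z).smulRight ν) z :=
      (P.hasFDerivAt.comp z (hθ.differentiable (by norm_num) z).hasFDerivAt).add
        ((hhd z).hasFDerivAt.smul_const ν)
    have h2 := (hu.differentiable (by norm_num) (A z)).hasFDerivAt.comp z h1
    have h3 : u ∘ A = fun _ => 0 := funext hA0
    rw [h3] at h2
    have h4 := congrArg (fun M : Euc n →L[ℝ] ℝ => M e) (h2.unique (hasFDerivAt_const (0 : ℝ) z))
    simp only [ContinuousLinearMap.comp_apply, add_apply, map_add,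
      ContinuousLinearMap.smulRight_apply, map_smul, smul_eq_mul,
      zero_apply] at h4
    have hne := (hc.trans_le (hlow _ (hAmem z))).ne'
    rw [eq_div_iff hne]
    linarith
  have hnum (z e : Euc n) : |fderiv ℝ u (A z) (P (fderiv ℝ θ z e))| ≤ C * ε * (T * ‖e‖) := by
    refine (htan _ (hAmem z) _ (hPν _)).trans (mul_le_mul_of_nonneg_left ?_ (by positivity))
    exact (hPle _).trans (((fderiv ℝ θ z).le_opNorm e).trans
      (mul_le_mul_of_nonneg_right (hDθ z) (norm_nonneg e)))
  have hDh (z : Euc n) : ‖fderiv ℝ h z‖ ≤ C * T / c := by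
    refine ContinuousLinearMap.opNorm_le_bound _ (by positivity) fun e => ?_
    have hd := hlow _ (hAmem z)
    rw [hform, Real.norm_eq_abs, abs_div, abs_neg, abs_of_pos (hc.trans_le hd)]
    calc _ ≤ C * ε * (T * ‖e‖) / c := by
          gcongr
          exact hnum z e
      _ ≤ C * 1 * (T * ‖e‖) / c := by gcongr
      _ = _ := by ring
  have hhlip (z z' : Euc n) : |h z - h z'| ≤ C * T / c * ‖z - z'‖ :=
    convex_univ.norm_image_sub_le_of_norm_fderiv_le (fun x _ => hhd x) (fun x _ => hDh x)
      (mem_univ z') (mem_univ z)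
  have hAlip (z z' : Euc n) : ‖A z - A z'‖ ≤ Λ * ‖z - z'‖ := by
    have e : A z - A z' = P (θ z - θ z') + (h z - h z') • ν := by
      simp only [hA, map_sub, sub_smul]; abel
    rw [e, hΛ, add_mul]
    refine (norm_add_le _ _).trans (add_le_add ((hPle _).trans (hθlip z z')) ?_)
    rw [norm_smul, hν, mul_one]
    exact hhlip z z'
  refine ⟨h, hhC, fun z => ?_, fun x hx => ?_⟩
  · rw [← norm_iteratedFDeriv_fderiv (n := 1), norm_iteratedFDeriv_one]
    refine norm_fderiv_le_of_lip' ℝ (by positivity) (Eventually.of_forall fun z' => ?_)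
    refine ContinuousLinearMap.opNorm_le_bound _ (by positivity) fun e => ?_
    rw [sub_apply, hform, hform, Real.norm_eq_abs]
    have hN : |fderiv ℝ u (A z') (P (fderiv ℝ θ z' e)) - fderiv ℝ u (A z) (P (fderiv ℝ θ z e))| ≤
        C * ε * (Λ * ‖z' - z‖) * (T * ‖e‖) + C * ε * (T * ‖z' - z‖ * ‖e‖) := by
      have e1 : fderiv ℝ u (A z') (P (fderiv ℝ θ z' e)) - fderiv ℝ u (A z) (P (fderiv ℝ θ z e)) =
          (fderiv ℝ u (A z') (P (fderiv ℝ θ z' e)) - fderiv ℝ u (A z) (P (fderiv ℝ θ z' e))) +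
            fderiv ℝ u (A z) (P ((fderiv ℝ θ z' - fderiv ℝ θ z) e)) := by
        simp only [sub_apply, map_sub]; ring
      rw [e1]
      refine (abs_add_le _ _).trans (add_le_add ?_ ?_)
      · refine (htanlip _ (hAmem z) _ (hAmem z') _ (hPν _)).trans ?_
        have h1 : ‖P (fderiv ℝ θ z' e)‖ ≤ T * ‖e‖ :=
          (hPle _).trans (((fderiv ℝ θ z').le_opNorm e).trans
            (mul_le_mul_of_nonneg_right (hDθ z') (norm_nonneg e)))
        have h2 := hAlip z' z
        gcongr
      · refine (htan _ (hAmem z) _ (hPν _)).trans (mul_le_mul_of_nonneg_left ?_ (by positivity))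
        exact (hPle _).trans (((fderiv ℝ θ z' - fderiv ℝ θ z).le_opNorm e).trans
          (mul_le_mul_of_nonneg_right (hDθlip z' z) (norm_nonneg e)))
    have hd : |fderiv ℝ u (A z') ν - fderiv ℝ u (A z) ν| ≤ C * (Λ * ‖z' - z‖) := by
      have h1 := hlip _ (hAmem z) _ (hAmem z') ν
      rw [hν, mul_one] at h1
      exact h1.trans (mul_le_mul_of_nonneg_left (hAlip z' z) hC)
    refine (abs_neg_div_sub_neg_div_le hc (hlow _ (hAmem z')) (hlow _ (hAmem z)) hN (hnum z e)
      hd).trans ?_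
    have e2 : (C * ε * (Λ * ‖z' - z‖) * (T * ‖e‖) + C * ε * (T * ‖z' - z‖ * ‖e‖)) / c +
        C * ε * (T * ‖e‖) * (C * (Λ * ‖z' - z‖)) / c ^ 2 =
        ((C * Λ * T + C * T) / c + C * T * (C * Λ) / c ^ 2) * (ε * ‖z' - z‖ * ‖e‖) := by
      field_simp
    rw [e2]
    calc _ ≤ ((C * Λ * T + C * T) / c + C * T * (C * Λ) / c ^ 2 + 1) * (ε * ‖z' - z‖ * ‖e‖) :=
          mul_le_mul_of_nonneg_right (by linarith) (by positivity)
      _ = _ := by ring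
  · rw [← tangentialPart_apply]
    have hx2 : ‖P x‖ ^ 2 + (⟪x, ν⟫ - R) ^ 2 < 1 := by
      rw [mem_ball, dist_eq_norm] at hx
      have h1 := norm_sq_add_smul hν (hPν x) (⟪x, ν⟫ - R)
      have h2 : P x + (⟪x, ν⟫ - R) • ν = x - R • ν := by
        rw [hP, tangentialPart_apply, sub_smul]; abel
      rw [h2] at h1
      nlinarith [norm_nonneg (x - R • ν)]
    have hPx : ‖P x‖ ≤ 1 := by nlinarith [sq_nonneg (⟪x, ν⟫ - R), norm_nonneg (P x)]
    have hs : ⟪x, ν⟫ ∈ Icc (R - 1) (R + 1) := by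
      constructor <;> nlinarith [sq_nonneg ‖P x‖]
    have hXx : X (P x, ⟪x, ν⟫) = x := by
      simp only [hX]
      rw [hθid _ hPx, hP, tangentialPart_of_inner_eq_zero (hPν x), tangentialPart_apply,
        sub_add_cancel]
    have := hhiff (P x) ⟪x, ν⟫ hs
    rwa [Function.comp_apply, hXx] at this

end Graph

section RadialBarrier

variable {n : ℕ}

/-- On a compact interval the one-dimensional solution is bi-Lipschitz. -/
lemma IsOneDSolution.exists_bilipschitz {W g : ℝ → ℝ} (hg : IsOneDSolution W g) :
    ∃ c L : ℝ, 0 < c ∧ 0 < L ∧ (∀ t ∈ Icc (-4:ℝ) 4, c ≤ deriv g t) ∧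
      ∀ s ∈ Icc (-4:ℝ) 4, ∀ t ∈ Icc (-4:ℝ) 4, s ≤ t →
        c * (t - s) ≤ g t - g s ∧ g t - g s ≤ L * (t - s) := by
  obtain ⟨hgC, -, -, hpos, -⟩ := hg
  have hne : (Icc (-4:ℝ) 4).Nonempty := ⟨0, by norm_num⟩
  have hcont : ContinuousOn (deriv g) (Icc (-4:ℝ) 4) :=
    (hgC.continuous_deriv (by norm_num)).continuousOn
  obtain ⟨a, -, hmin⟩ := isCompact_Icc.exists_isMinOn hne hcont
  obtain ⟨b, -, hmax⟩ := isCompact_Icc.exists_isMaxOn hne hcont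
  have hd : Differentiable ℝ g := hgC.differentiable (by norm_num)
  refine ⟨deriv g a, deriv g b, hpos a, hpos b, fun t ht => hmin ht, fun s hs t ht hst => ⟨?_, ?_⟩⟩
  · exact (convex_Icc (-4:ℝ) 4).mul_sub_le_image_sub_of_le_deriv hd.continuous.continuousOn
      hd.differentiableOn (fun x hx => hmin (interior_subset hx)) s hs t ht hst
  · exact (convex_Icc (-4:ℝ) 4).image_sub_le_mul_sub_of_deriv_le hd.continuous.continuousOn
      hd.differentiableOn (fun x hx => hmax (interior_subset hx)) s hs t ht hst

/-- Near a point of the sphere of radius `R`, the distance to the origin is close to the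
coordinate in the radial direction. -/
lemma norm_sub_inner_le {ν x : Euc n} {R : ℝ} (hν : ‖ν‖ = 1) (hR : 8 ≤ R)
    (hx : x ∈ ball (R • ν) 4) :
    ⟪x, ν⟫ - R ∈ Icc (-4:ℝ) 4 ∧ ‖x‖ - R ∈ Icc (-4:ℝ) 4 ∧
      0 ≤ ‖x‖ - ⟪x, ν⟫ ∧ ‖x‖ - ⟪x, ν⟫ ≤ 16 / R := by
  rw [mem_ball, dist_eq_norm] at hx
  have hRν : ‖R • ν‖ = R := by rw [norm_smul, hν, mul_one, Real.norm_of_nonneg (by linarith)]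
  have hinner : ⟪x - R • ν, ν⟫ = ⟪x, ν⟫ - R := by
    rw [inner_sub_left, real_inner_smul_left, real_inner_self_eq_norm_sq, hν]; ring
  have hs : |⟪x, ν⟫ - R| ≤ ‖x - R • ν‖ := by
    rw [← hinner]
    simpa [hν] using abs_real_inner_le_norm (x - R • ν) ν
  have hr : |‖x‖ - R| ≤ ‖x - R • ν‖ := by
    simpa [hRν] using abs_norm_sub_norm_le x (R • ν)
  have hle : ⟪x, ν⟫ ≤ ‖x‖ := by simpa [hν] using real_inner_le_norm x ν
  have hs' := abs_le.1 (hs.trans hx.le)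
  have hr' := abs_le.1 (hr.trans hx.le)
  refine ⟨hs', hr', by linarith, ?_⟩
  have hsq : ‖x‖ ^ 2 - ⟪x, ν⟫ ^ 2 ≤ 16 := by
    have h := norm_sub_sq_real x (R • ν)
    rw [real_inner_smul_right, hRν] at h
    nlinarith [norm_nonneg (x - R • ν), sq_nonneg (⟪x, ν⟫ - R)]
  rw [le_div_iff₀ (by linarith)]
  nlinarith

/-- A radial barrier which is close to `g (|x| - R)` lies below the planar profile, up to an error
of order `1 / R`. -/
lemma radial_le_planar {g gR : ℝ → ℝ} {c L C₀ R : ℝ} {ν x : Euc n} (hν : ‖ν‖ = 1) (hR : 8 ≤ R)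
    (hL : 0 < L)
    (hlip : ∀ s ∈ Icc (-4:ℝ) 4, ∀ t ∈ Icc (-4:ℝ) 4, s ≤ t →
        c * (t - s) ≤ g t - g s ∧ g t - g s ≤ L * (t - s))
    (hgR : ∀ t ∈ Icc (-4:ℝ) 4, |g t - gR t| ≤ C₀ / R) (hx : x ∈ ball (R • ν) 4) :
    gR (‖x‖ - R) ≤ g (⟪x, ν⟫ - R) + (16 * L + C₀) / R := by
  obtain ⟨hs, hr, h0, h16⟩ := norm_sub_inner_le hν hR hx
  have h1 := (hlip _ hs _ hr (by linarith)).2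
  have h2 := (abs_le.1 (hgR _ hr)).1
  have h3 : L * (‖x‖ - R - (⟪x, ν⟫ - R)) ≤ L * (16 / R) :=
    mul_le_mul_of_nonneg_left (by linarith) hL.le
  have h4 : (16 * L + C₀) / R = L * (16 / R) + C₀ / R := by ring
  linarith

/-- In a ball centred on the sphere of radius `R`, the zeros of a function close to the planar
profile are close to that sphere. -/
lemma abs_norm_sub_le_of_eq_zero {g : ℝ → ℝ} {u : Euc n → ℝ} {c L δ R : ℝ} {ν x : Euc n}
    (hν : ‖ν‖ = 1) (hR : 8 ≤ R) (hc : 0 < c) (hg0 : g 0 = 0)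
    (hlip : ∀ s ∈ Icc (-4:ℝ) 4, ∀ t ∈ Icc (-4:ℝ) 4, s ≤ t →
        c * (t - s) ≤ g t - g s ∧ g t - g s ≤ L * (t - s))
    (hx : x ∈ ball (R • ν) 4) (hux : |u x - g (⟪x, ν⟫ - R)| ≤ δ) (h0 : u x = 0) :
    |‖x‖ - R| ≤ 16 / R + δ / c := by
  obtain ⟨hs, hr, h1, h16⟩ := norm_sub_inner_le hν hR hx
  have hz : (0:ℝ) ∈ Icc (-4:ℝ) 4 := by norm_num
  rw [h0, zero_sub, abs_neg] at hux
  have hsd : |⟪x, ν⟫ - R| ≤ δ / c := by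
    rw [le_div_iff₀ hc]
    have hux' := abs_le.1 hux
    rcases le_total 0 (⟪x, ν⟫ - R) with h | h
    · have := (hlip _ hz _ hs h).1
      rw [abs_of_nonneg h]; linarith
    · have := (hlip _ hs _ hz h).1
      rw [abs_of_nonpos h]; linarith
  have h2 : ‖x‖ - R = (‖x‖ - ⟪x, ν⟫) + (⟪x, ν⟫ - R) := by ring
  rw [h2]
  refine (abs_add_le _ _).trans (add_le_add ?_ hsd)
  rwa [abs_of_nonneg h1]

end RadialBarrier

/-- estimates near an almost-contact point, Remark 2.3: if `φ_R ≥ u` and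
`u(y) ≥ φ_R(y) - K/R` at some `y` in the annulus `B_{R+1}∖B_{R-1}`, the same conclusions hold
with a constant `C(K)` depending also on `K`. -/
theorem estimates_near_almost_contact_point
    (n : ℕ) (hn : 1 ≤ n) (W : ℝ → ℝ) (hW : DoubleWell W)
    (g : ℝ → ℝ) (hg : IsOneDSolution W g) (C₀ : ℝ) (hC₀ : 0 < C₀)
    (K : ℝ) (hK : 0 < K) :
    ∃ C : ℝ, 0 < C ∧ ∃ R₀ : ℝ, ∀ R : ℝ, R₀ ≤ R →
      ∀ gR : ℝ → ℝ,
        (∀ t, gR t ∈ Set.Icc (-1:ℝ) 1) → Monotone gR →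
        (∀ t ≤ -(R/2), gR t = gR (-(R/2))) → (∀ t, R/2 ≤ t → gR t = gR (R/2)) →
        gR 0 = 0 →
        (∀ t ∈ Set.Icc (-4:ℝ) 4, |g t - gR t| ≤ C₀ / R) →
        ViscSuperLap n (fun x => gR (‖x‖ - R))
          (fun x => deriv W (gR (‖x‖ - R)) +
            (C₀ / R) * Set.indicator (Metric.ball (0 : EuclideanSpace ℝ (Fin n)) (R+1) \
              Metric.ball 0 (R-1)) (fun _ => (1:ℝ)) x) →
      ∀ u : EuclideanSpace ℝ (Fin n) → ℝ,
        ContDiff ℝ 2 u → (∀ x, u x ∈ Set.Ioo (-1:ℝ) 1) →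
        (∀ x, lap n u x = deriv W (u x)) →
        (∀ x, u x ≤ gR (‖x‖ - R)) →
      ∀ y : EuclideanSpace ℝ (Fin n),
        R - 1 ≤ ‖y‖ → ‖y‖ < R + 1 →
        gR (‖y‖ - R) - K / R ≤ u y →
        (∀ πy ν : EuclideanSpace ℝ (Fin n), πy = (R / ‖y‖) • y → ν = ‖y‖⁻¹ • y →
          (∃ h : EuclideanSpace ℝ (Fin n) → ℝ, ContDiff ℝ 2 h ∧
            (∀ z, ‖iteratedFDeriv ℝ 2 h z‖ ≤ C / R) ∧
            (∀ x ∈ Metric.ball πy 1, (u x = 0 ↔ ⟪x, ν⟫ = h (x - ⟪x, ν⟫ • ν)))) ∧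
          (∀ x ∈ Metric.ball πy 1, u x = 0 → |‖x‖ - R| ≤ C / R) ∧
          (∀ x ∈ Metric.ball πy 1, |u x - g (⟪x, ν⟫ - R)| ≤ C / R)) := by
  obtain ⟨c, L, hc, hL, hcd, hlip⟩ := hg.exists_bilipschitz
  obtain ⟨A, hA, htwo⟩ := exists_two_sided_bound n hW hg
  obtain ⟨D, hD, hder⟩ := exists_derivative_estimates n hW hg
  obtain ⟨G, hG, hgraph⟩ := exists_graph n (c := c / 2) (half_pos hc) hD.le
  obtain ⟨M, hM⟩ : ∃ M, M = 16 * L + C₀ + K := ⟨_, rfl⟩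
  have hM0 : 0 < M := by rw [hM]; positivity
  have hB : 0 < A * M := mul_pos hA hM0
  have hg0 : g 0 = 0 := hg.2.2.2.2.1
  have hg1 : c ≤ g 1 := by
    have := (hlip 0 (by norm_num) 1 (by norm_num) (by norm_num)).1
    rw [hg0] at this; linarith
  have hg1' : g (-1) ≤ -c := by
    have := (hlip (-1) (by norm_num) 0 (by norm_num) (by norm_num)).1
    rw [hg0] at this; linarith
  have hG0 : 0 < G * (A * M) := mul_pos hG hB
  have hBc : 0 < A * M / c := div_pos hB hc
  refine ⟨G * (A * M) + A * M + (16 + A * M / c), by positivity,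
    8 + A * M + 2 * (D + 1) * (A * M) / c, ?_⟩
  intro R hR gR _ _ _ _ _ hgR _ u hu hu1 hlap hle y hy1 hy2 hy πy ν hπ hν
  have hDB : 0 < 2 * (D + 1) * (A * M) / c := by positivity
  have hR8 : 8 ≤ R := by linarith
  have hR0 : 0 < R := by linarith
  have hy0 : 0 < ‖y‖ := by linarith
  have hν1 : ‖ν‖ = 1 := by
    rw [hν, norm_smul, norm_inv, norm_norm, inv_mul_cancel₀ hy0.ne']
  have hπν : πy = R • ν := by rw [hπ, hν, smul_smul, div_eq_mul_inv]
  have hyν : y = ‖y‖ • ν := by rw [hν, smul_smul, mul_inv_cancel₀ hy0.ne', one_smul]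
  rw [hπν]
  have hyinner : ⟪y, ν⟫ = ‖y‖ := by
    rw [hν, real_inner_smul_right, real_inner_self_eq_norm_sq, sq, inv_mul_cancel_left₀ hy0.ne']
  have hyball : y ∈ closedBall (R • ν) 3 := by
    have h1 : y - R • ν = (‖y‖ - R) • ν := by rw [sub_smul, ← hyν]
    rw [mem_closedBall, dist_eq_norm, h1, norm_smul, hν1, mul_one, Real.norm_eq_abs, abs_le]
    constructor <;> linarith
  have hupper : ∀ x ∈ ball (R • ν) 4, u x ≤ g (⟪x, ν⟫ - R) + M / R := fun x hx => by
    have h1 := radial_le_planar hν1 hR8 hL hlip hgR hx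
    have h2 : M / R = (16 * L + C₀) / R + K / R := by rw [hM]; ring
    have h3 : 0 < K / R := div_pos hK hR0
    linarith [hle x]
  have hlower : g (⟪y, ν⟫ - R) ≤ u y + M / R := by
    rw [hyinner]
    have h1 := (abs_le.1 (hgR (‖y‖ - R) ⟨by linarith, by linarith⟩)).2
    have h2 : M / R = 16 * L / R + C₀ / R + K / R := by rw [hM]; ring
    have h3 : 0 < 16 * L / R := by positivity
    linarith
  have hclose := htwo ν (R • ν) R (M / R) u hν1 (div_pos hM0 hR0) hu hu1 hlap hupper
    ⟨y, hyball, hlower⟩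
  have hAM : A * (M / R) = A * M / R := by ring
  rw [hAM] at hclose
  set ε := A * M / R with hε
  have hε0 : 0 < ε := div_pos hB hR0
  have hε1 : ε ≤ 1 := by rw [hε, div_le_one hR0]; linarith
  have hεc : (D + 1) * ε ≤ c / 2 := by
    have h1 : 2 * (D + 1) * (A * M) / c ≤ R := by linarith
    rw [div_le_iff₀ hc] at h1
    rw [hε, ← mul_div_assoc, div_le_iff₀ hR0]
    linarith
  have hDε : 0 < D * ε := mul_pos hD hε0
  obtain ⟨hd1, hd2, hd3⟩ := hder ν (R • ν) R ε u hν1 hε0.le hu hu1 hlap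
    fun x hx => hclose x (ball_subset_closedBall hx)
  have hin : ∀ x ∈ ball (R • ν) 2, x ∈ ball (R • ν) 4 := fun x hx =>
    ball_subset_ball (by norm_num) hx
  have hnear : ∀ x ∈ ball (R • ν) 2, |u x - g (⟪x, ν⟫ - R)| ≤ ε := fun x hx =>
    hclose x (ball_subset_closedBall (ball_subset_ball (by norm_num) hx))
  have hC (a b d : ℝ) (ha : 0 ≤ a) (hb : 0 ≤ b) (hd : 0 ≤ d) :
      a / R ≤ (a + b + d) / R ∧ b / R ≤ (a + b + d) / R ∧ d / R ≤ (a + b + d) / R :=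
    ⟨by gcongr; linarith, by gcongr; linarith, by gcongr; linarith⟩
  obtain ⟨hC1, hC2, hC3⟩ := hC (G * (A * M)) (A * M) (16 + A * M / c) hG0.le hB.le (by positivity)
  have hsub : ball (R • ν) 1 ⊆ ball (R • ν) 2 := ball_subset_ball (by norm_num)
  refine ⟨?_, fun x hx h0 => ?_, fun x hx => (hnear x (hsub hx)).trans hC2⟩
  · obtain ⟨h, hh, hh2, hhz⟩ := hgraph ν R ε u hν1 hε0.le hε1 hu
      (fun x hx => by
        have h1 := (abs_le.1 (hd1 x hx ν)).1
        have h2 := hcd _ (norm_sub_inner_le hν1 hR8 (hin x hx)).1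
        rw [real_inner_self_eq_norm_sq, hν1] at h1
        linarith)
      (fun x hx e he => by simpa [he] using hd1 x hx e) hd2 hd3
      (fun x hx hxR => by
        have h1 := (abs_le.1 (hnear x hx)).2
        have h2 : ⟪x, ν⟫ - R = -1 := by rw [hxR]; ring
        rw [h2] at h1
        linarith)
      (fun x hx hxR => by
        have h1 := (abs_le.1 (hnear x hx)).1
        have h2 : ⟪x, ν⟫ - R = 1 := by rw [hxR]; ring
        rw [h2] at h1
        linarith)
    refine ⟨h, hh, fun z => (hh2 z).trans ?_, hhz⟩
    rwa [hε, ← mul_div_assoc]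
  · refine (abs_norm_sub_le_of_eq_zero hν1 hR8 hc hg0 hlip (hin x (hsub hx)) (hnear x (hsub hx))
      h0).trans ?_
    have h1 : 16 / R + ε / c = (16 + A * M / c) / R := by rw [hε]; ring
    rwa [h1]

end
end
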